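/- Let f be a real polynomial in N variables with exactly n+k+1 monomials (where n ≥ 1, k ≥ 0) whose set of exponent vectors, regarded as points of ℝ^N, has affine span of dimension n. Suppose the zero set X = {x ∈ ℝ^N_> : f(x) = 0} is a smooth hypersurface, i.e., the gradient ∇f(x) is nonzero at every point x of X. Then X has fewer than ((e² + 3)/4) · 2^(k(k+1)/2) · 2^n · n^(k+1) connected components; in particular the number of connected components of X is finite. -/

import Mathlib

/-- The set of connected components of a subset `X` of `ℝ^N`, as subsets of `ℝ^N`. -/
def components {N : ℕ} (X : Set (Fin N → ℝ)) : Set (Set (Fin N → ℝ)) :=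
  {C | ∃ x ∈ X, C = connectedComponentIn X x}

open Filter Topology

/-- For all but finitely many `s`, the system `x i ^ d i + s * q i x = 0` has at most `∏ d i`
solutions. -/
theorem finite_bad_parameters_bezout {K : ℕ} (d : Fin K → ℕ)
    (q : Fin K → MvPolynomial (Fin K) ℝ) (hq : ∀ i, (q i).totalDegree ≤ d i) :
    {s : ℝ | ∃ S : Finset (Fin K → ℝ), ∏ i, d i < S.card ∧
      ∀ x ∈ S, ∀ i, x i ^ d i + s * MvPolynomial.eval x (q i) = 0}.Finite := by
  classical
  set D := ∏ i, d i with hD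
  let A : Finset (Fin K →₀ ℕ) := (Finsupp.finite_of_degree_le (σ := Fin K) D).toFinset
  have memA : ∀ a, a ∈ A ↔ a.degree ≤ D := fun a => by simp [A]
  -- choice of an overflowing index
  let Box : (Fin K →₀ ℕ) → Prop := fun a => ∀ i, a i < d i
  have hchoice : ∀ a : Fin K →₀ ℕ, ∃ P : MvPolynomial (Fin K) ℝ, P.totalDegree ≤ a.degree ∧
      ∀ (s : ℝ) (x : Fin K → ℝ), (∀ i, x i ^ d i + s * MvPolynomial.eval x (q i) = 0) →
        MvPolynomial.eval x (MvPolynomial.monomial a 1) + s * MvPolynomial.eval x P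
          = if Box a then MvPolynomial.eval x (MvPolynomial.monomial a 1) else 0 := by
    intro a
    by_cases ha : Box a
    · exact ⟨0, by simp, by simp [ha]⟩
    · obtain ⟨i, hi⟩ : ∃ i, d i ≤ a i := by simpa [Box] using ha
      have hsplit : a = (a - Finsupp.single i (d i)) + Finsupp.single i (d i) := by
        rw [tsub_add_cancel_of_le]; simpa using hi
      refine ⟨MvPolynomial.monomial (a - Finsupp.single i (d i)) 1 * q i, ?_, ?_⟩
      · refine (MvPolynomial.totalDegree_mul _ _).trans ?_
        have h1 : (MvPolynomial.monomial (a - Finsupp.single i (d i)) (1 : ℝ)).totalDegree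
            = (a - Finsupp.single i (d i)).degree := by
          rw [MvPolynomial.totalDegree_monomial _ one_ne_zero]; rfl
        have h2 : a.degree = (a - Finsupp.single i (d i)).degree + d i := by
          conv_lhs => rw [hsplit]
          rw [map_add, Finsupp.degree_single]
        rw [h1, h2]
        exact Nat.add_le_add_left (hq i) _
      · intro s x hx
        rw [if_neg ha]
        have h3 : MvPolynomial.monomial a (1 : ℝ)
            = MvPolynomial.monomial (a - Finsupp.single i (d i)) 1 * MvPolynomial.X i ^ d i := by
          rw [MvPolynomial.X_pow_eq_monomial, MvPolynomial.monomial_mul, ← hsplit, one_mul]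
        rw [h3]
        simp only [map_mul, map_pow, MvPolynomial.eval_X]
        linear_combination
          (MvPolynomial.eval x (MvPolynomial.monomial (a - Finsupp.single i (d i)) (1:ℝ))) * hx i
  choose P hPdeg hP using hchoice
  let Nm : Matrix A A ℝ := fun a b => MvPolynomial.coeff b.1 (P a.1)
  -- eval as a sum over A
  have heval : ∀ Q : MvPolynomial (Fin K) ℝ, Q.totalDegree ≤ D → ∀ x : Fin K → ℝ,
      MvPolynomial.eval x Q = ∑ b : A, MvPolynomial.coeff b.1 Q *
        MvPolynomial.eval x (MvPolynomial.monomial b.1 1) := by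
    intro Q hQ x
    have hs : Q.support ⊆ A := fun b hb => by
      rw [memA]
      exact (MvPolynomial.le_totalDegree hb).trans hQ
    conv_lhs => rw [Q.as_sum]
    rw [map_sum, Finset.sum_subset hs, ← Finset.sum_coe_sort A]
    · refine Finset.sum_congr rfl fun b _ => ?_
      simp [MvPolynomial.eval_monomial]
    · intro b _ hb
      simp [MvPolynomial.notMem_support_iff.mp hb]
  -- bad parameters are roots of a polynomial
  let R : Polynomial ℝ := (-Nm).charpolyRev
  have hR0 : R ≠ 0 := by
    intro h
    have : Polynomial.eval 0 R = 1 := Matrix.eval_charpolyRev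
    simp [h] at this
  have hReval : ∀ s : ℝ, R.eval s = (1 + s • Nm).det := by
    intro s
    simp only [R, Matrix.charpolyRev]
    rw [← Polynomial.coe_evalRingHom, RingHom.map_det]
    congr 1
    ext a b
    by_cases hab : a = b <;> simp [hab] <;> ring
  refine (R.roots.toFinset.finite_toSet).subset ?_
  rintro s ⟨S', hcard', hS'⟩
  by_contra hs
  have hdet : (1 + s • Nm).det ≠ 0 := by
    rw [← hReval]
    intro h
    exact hs (by simp [hR0, h])
  obtain ⟨S, hSS', hScard⟩ := Finset.exists_subset_card_eq (show D + 1 ≤ S'.card from hcard')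
  have hS : ∀ x ∈ S, ∀ i, x i ^ d i + s * MvPolynomial.eval x (q i) = 0 :=
    fun x hx => hS' x (hSS' hx)
  let e : A → (S → ℝ) := fun a x => MvPolynomial.eval x.1 (MvPolynomial.monomial a.1 1)
  let BoxF := (Finset.univ : Finset A).filter (fun a => Box a.1)
  have hspan : ∀ a, e a ∈ Submodule.span ℝ (Set.range fun b : BoxF => e b.1) := by
    intro a
    have key : ∀ b : A, ∑ c, (1 + s • Nm) b c • e c = if Box b.1 then e b else 0 := by
      intro b
      ext x
      have := hP b.1 s x.1 (hS x.1 x.2)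
      rw [heval (P b.1) ((hPdeg b.1).trans ((memA _).1 b.2))] at this
      rw [Finset.sum_apply]
      simp only [Pi.smul_apply, smul_eq_mul, Matrix.add_apply, Matrix.smul_apply, add_mul,
        Finset.sum_add_distrib, Matrix.one_apply]
      rw [show (if Box b.1 then e b else 0) x = if Box b.1 then
        MvPolynomial.eval x.1 (MvPolynomial.monomial b.1 1) else 0 by split_ifs <;> rfl, ← this]
      simp [e, Nm, Finset.mul_sum, mul_assoc]
    have hinv : (1 + s • Nm)⁻¹ * (1 + s • Nm) = 1 :=
      Matrix.nonsing_inv_mul _ (isUnit_iff_ne_zero.2 hdet)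
    have h2 : e a = ∑ b, (1 + s • Nm)⁻¹ a b • (if Box b.1 then e b else 0) := by
      simp_rw [← key, Finset.smul_sum, smul_smul]
      rw [Finset.sum_comm]
      simp_rw [← Finset.sum_smul, ← Matrix.mul_apply, hinv, Matrix.one_apply]
      simp
    rw [h2]
    refine Submodule.sum_mem _ fun b _ => Submodule.smul_mem _ _ ?_
    split_ifs with hb
    · exact Submodule.subset_span ⟨⟨b, by simp [BoxF, hb]⟩, rfl⟩
    · exact Submodule.zero_mem _
  have htop : Submodule.span ℝ (Set.range fun b : BoxF => e b.1) = ⊤ := by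
    rw [eq_top_iff, ← (Pi.basisFun ℝ S).span_eq, Submodule.span_le]
    rintro _ ⟨x0, rfl⟩
    have hsep : ∀ y : S, ∃ i : Fin K, y ≠ x0 → y.1 i ≠ x0.1 i := by
      intro y
      by_cases h : y = x0
      · have : 0 < K := by
          rcases Nat.eq_zero_or_pos K with h0 | h0
          · subst h0
            have : S.card ≤ 1 := Finset.card_le_one.2 fun a _ b _ => Subsingleton.elim _ _
            simp [D] at hScard
            omega
          · exact h0
        exact ⟨⟨0, this⟩, fun h' => absurd h h'⟩
      · have : y.1 ≠ x0.1 := fun h' => h (Subtype.ext h')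
        obtain ⟨i, hi⟩ := Function.ne_iff.1 this
        exact ⟨i, fun _ => hi⟩
    choose ind hind using hsep
    let Q : MvPolynomial (Fin K) ℝ := ∏ y ∈ Finset.univ.erase x0,
      (MvPolynomial.X (ind y) - MvPolynomial.C (y.1 (ind y)))
    have hQdeg : Q.totalDegree ≤ D := by
      refine (MvPolynomial.totalDegree_finsetProd _ _).trans ?_
      refine (Finset.sum_le_card_nsmul _ _ 1 ?_).trans ?_
      · intro y _
        refine (MvPolynomial.totalDegree_sub _ _).trans ?_
        simp
      · rw [Finset.card_erase_of_mem (Finset.mem_univ _)]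
        simp [hScard]
    have hQx0 : MvPolynomial.eval x0.1 Q ≠ 0 := by
      simp only [Q, map_prod, map_sub, MvPolynomial.eval_X, MvPolynomial.eval_C]
      refine Finset.prod_ne_zero_iff.2 fun y hy => sub_ne_zero.2 ?_
      exact (hind y (Finset.ne_of_mem_erase hy)).symm
    have hQy : ∀ y : S, y ≠ x0 → MvPolynomial.eval y.1 Q = 0 := by
      intro y hy
      simp only [Q, map_prod, map_sub, MvPolynomial.eval_X, MvPolynomial.eval_C]
      exact Finset.prod_eq_zero (Finset.mem_erase.2 ⟨hy, Finset.mem_univ _⟩) (sub_self _)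
    have : (Pi.basisFun ℝ S) x0 = (MvPolynomial.eval x0.1 Q)⁻¹ •
        ∑ b : A, MvPolynomial.coeff b.1 Q • e b := by
      ext y
      have h1 : (∑ b : A, MvPolynomial.coeff b.1 Q • e b) y = MvPolynomial.eval y.1 Q := by
        rw [heval Q hQdeg, Finset.sum_apply]; rfl
      rw [Pi.smul_apply, h1, Pi.basisFun_apply]
      by_cases hy : y = x0
      · subst hy; simp [hQx0]
      · simp [hy, hQy y hy]
    rw [this]
    exact Submodule.smul_mem _ _ (Submodule.sum_mem _ fun b _ => Submodule.smul_mem _ _ (hspan b))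
  have h1 : S.card ≤ BoxF.card := by
    have := finrank_range_le_card (R := ℝ) (fun b : BoxF => e b.1)
    rw [Set.finrank, htop, finrank_top, Module.finrank_fintype_fun_eq_card, Fintype.card_coe,
      Fintype.card_coe] at this
    exact this
  have h2 : BoxF.card ≤ D := by
    have : BoxF.card ≤ (Fintype.piFinset fun i => Finset.range (d i)).card := by
      refine Finset.card_le_card_of_injOn (fun a i => a.1 i) ?_ ?_
      · intro a ha
        have : Box a.1 := by simpa [BoxF] using ha
        simpa using this
      · intro a _ b _ hab
        exact Subtype.ext (Finsupp.ext fun i => congrFun hab i)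
    simpa [D] using this
  omega

theorem MvPolynomial.totalDegree_pderiv_le {K : ℕ} (l : Fin K) (p : MvPolynomial (Fin K) ℝ) :
    (MvPolynomial.pderiv l p).totalDegree ≤ p.totalDegree - 1 := by
  classical
  conv_lhs => rw [p.as_sum, map_sum]
  refine MvPolynomial.totalDegree_finsetSum_le fun a ha => ?_
  rw [MvPolynomial.pderiv_monomial]
  by_cases hal : a l = 0
  · simp [hal]
  · refine (MvPolynomial.totalDegree_monomial_le _ _).trans ?_
    have h1 : a.degree = (a - Finsupp.single l 1).degree + 1 := by
      conv_lhs => rw [← tsub_add_cancel_of_le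
        (show Finsupp.single l 1 ≤ a by simpa [Nat.one_le_iff_ne_zero] using hal)]
      rw [map_add, Finsupp.degree_single]
    have h2 : a.degree ≤ p.totalDegree := MvPolynomial.le_totalDegree ha
    change (a - Finsupp.single l 1).degree ≤ _
    omega

theorem MvPolynomial.hasStrictFDerivAt_eval {K : ℕ} (p : MvPolynomial (Fin K) ℝ)
    (x : Fin K → ℝ) :
    HasStrictFDerivAt (fun y => MvPolynomial.eval y p)
      (∑ l, MvPolynomial.eval x (MvPolynomial.pderiv l p) •
        ContinuousLinearMap.proj (R := ℝ) (φ := fun _ : Fin K => ℝ) l) x := by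
  classical
  induction p using MvPolynomial.induction_on with
  | C a => simpa using hasStrictFDerivAt_const a x
  | add p q hp hq =>
    refine (hp.add hq).congr_fderiv ?_ |>.congr_of_eventuallyEq ?_
    · ext; simp [add_mul, Finset.sum_add_distrib]
    · filter_upwards with y; simp
  | mul_X p i hp =>
    refine (hp.mul (hasStrictFDerivAt_apply i x)).congr_fderiv ?_ |>.congr_of_eventuallyEq ?_
    · ext v
      simp only [add_apply, smul_apply,
        sum_apply, ContinuousLinearMap.proj_apply, smul_eq_mul,
        Derivation.leibniz, map_add, map_mul, MvPolynomial.eval_X, MvPolynomial.pderiv_X]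
      simp only [add_mul, Finset.sum_add_distrib, Finset.mul_sum]
      congr 1
      · rw [Finset.sum_eq_single i]
        · simp
        · intro l _ hl; simp [hl.symm]
        · simp
      · exact Finset.sum_congr rfl fun l _ => by ring
    · filter_upwards with y; simp

theorem Matrix.totalDegree_det_le {R ρ σ : Type*} [CommRing R] [Fintype ρ] [DecidableEq ρ]
    (M : Matrix ρ ρ (MvPolynomial σ R)) (u v : ρ → ℤ)
    (h : ∀ r c, M r c = 0 ∨ ((M r c).totalDegree : ℤ) ≤ u r + v c) :
    M.det = 0 ∨ (M.det.totalDegree : ℤ) ≤ ∑ r, u r + ∑ c, v c := by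
  classical
  by_cases h0 : M.det = 0
  · exact Or.inl h0
  right
  have hterm : ∀ π : Equiv.Perm ρ, (∏ c, M (π c) c) = 0 ∨
      ((∏ c, M (π c) c).totalDegree : ℤ) ≤ ∑ r, u r + ∑ c, v c := by
    intro π
    by_cases hz : ∃ c, M (π c) c = 0
    · obtain ⟨c, hc⟩ := hz
      exact Or.inl (Finset.prod_eq_zero (Finset.mem_univ c) hc)
    · push Not at hz
      right
      have h1 := MvPolynomial.totalDegree_finsetProd Finset.univ (fun c => M (π c) c)
      have h2 : (((∏ c, M (π c) c).totalDegree : ℕ) : ℤ)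
          ≤ ∑ c, ((M (π c) c).totalDegree : ℤ) := by exact_mod_cast h1
      refine h2.trans ?_
      rw [← Equiv.sum_comp π u, ← Finset.sum_add_distrib]
      exact Finset.sum_le_sum fun c _ => (h (π c) c).resolve_left (hz c)
  obtain ⟨B, hB⟩ : ∃ B : ℕ, (B : ℤ) = ∑ r, u r + ∑ c, v c := by
    by_contra hneg
    refine h0 ?_
    rw [Matrix.det_apply]
    refine Finset.sum_eq_zero fun π _ => ?_
    rcases hterm π with h1 | h1
    · rw [h1, smul_zero]
    · exact absurd ⟨(∑ r, u r + ∑ c, v c).toNat, Int.toNat_of_nonneg (by omega)⟩ hneg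
  rw [← hB, Matrix.det_apply]
  norm_cast
  refine MvPolynomial.totalDegree_finsetSum_le fun π _ => ?_
  have h3 : (∏ c, M (π c) c).totalDegree ≤ B := by
    rcases hterm π with h1 | h1
    · rw [h1]; simp
    · exact_mod_cast hB ▸ h1
  rcases Int.units_eq_one_or (Equiv.Perm.sign π) with h4 | h4 <;> simp [h4, h3]

section LogPoly

variable {K : ℕ} {ι : Type*} [Fintype ι]

/-- The map whose `i`-th component is `∑ j, b i j * log (L j) + p i`. -/
noncomputable def logPolyMap (L : ι → MvPolynomial (Fin K) ℝ) (b : Fin K → ι → ℝ)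
    (p : Fin K → MvPolynomial (Fin K) ℝ) (x : Fin K → ℝ) : Fin K → ℝ := fun i =>
  ∑ j, b i j * Real.log (MvPolynomial.eval x (L j)) + MvPolynomial.eval x (p i)

/-- The Jacobian matrix of `logPolyMap`. -/
noncomputable def logPolyJacobian (L : ι → MvPolynomial (Fin K) ℝ) (b : Fin K → ι → ℝ)
    (p : Fin K → MvPolynomial (Fin K) ℝ) (x : Fin K → ℝ) : Matrix (Fin K) (Fin K) ℝ :=
  Matrix.of fun i l =>
    ∑ j, b i j * ((MvPolynomial.eval x (L j))⁻¹ * MvPolynomial.eval x (MvPolynomial.pderiv l (L j)))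
      + MvPolynomial.eval x (MvPolynomial.pderiv l (p i))

/-- A polynomial equal to the Jacobian determinant of `logPolyMap` times `∏ j, L j`. -/
noncomputable def logPolyDet [DecidableEq ι] (L : ι → MvPolynomial (Fin K) ℝ) (b : Fin K → ι → ℝ)
    (p : Fin K → MvPolynomial (Fin K) ℝ) : MvPolynomial (Fin K) ℝ :=
  (Matrix.fromBlocks (Matrix.diagonal L) (Matrix.of fun j l => MvPolynomial.pderiv l (L j))
    (Matrix.of fun i j => -MvPolynomial.C (b i j))
    (Matrix.of fun i l => MvPolynomial.pderiv l (p i))).det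

theorem hasStrictFDerivAt_logPolyMap (L : ι → MvPolynomial (Fin K) ℝ) (b : Fin K → ι → ℝ)
    (p : Fin K → MvPolynomial (Fin K) ℝ) (x : Fin K → ℝ)
    (hx : ∀ j, MvPolynomial.eval x (L j) ≠ 0) :
    HasStrictFDerivAt (logPolyMap L b p)
      (LinearMap.toContinuousLinearMap (Matrix.toLin' (logPolyJacobian L b p x))) x := by
  rw [hasStrictFDerivAt_pi']
  intro i
  have h1 : HasStrictFDerivAt (fun y => logPolyMap L b p y i) _ x :=
    (HasStrictFDerivAt.fun_sum (u := Finset.univ) fun j _ =>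
      (((L j).hasStrictFDerivAt_eval x).log (hx j)).const_mul (b i j)).add
      ((p i).hasStrictFDerivAt_eval x)
  refine h1.congr_fderiv ?_
  ext v
  simp only [add_apply, sum_apply,
    smul_apply, ContinuousLinearMap.proj_apply, smul_eq_mul,
    ContinuousLinearMap.comp_apply, LinearMap.coe_toContinuousLinearMap', Matrix.toLin'_apply,
    Matrix.mulVec, dotProduct, logPolyJacobian, Matrix.of_apply, add_mul,
    Finset.sum_add_distrib, Finset.sum_mul, Finset.mul_sum]
  congr 1
  rw [Finset.sum_comm]
  refine Finset.sum_congr rfl fun _ _ => Finset.sum_congr rfl fun _ _ => ?_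
  ring

theorem eval_logPolyDet [DecidableEq ι] (L : ι → MvPolynomial (Fin K) ℝ) (b : Fin K → ι → ℝ)
    (p : Fin K → MvPolynomial (Fin K) ℝ) (x : Fin K → ℝ)
    (hx : ∀ j, MvPolynomial.eval x (L j) ≠ 0) :
    MvPolynomial.eval x (logPolyDet L b p)
      = (∏ j, MvPolynomial.eval x (L j)) * (logPolyJacobian L b p x).det := by
  rw [logPolyDet, RingHom.map_det]
  have hmap : (MvPolynomial.eval x).mapMatrix (Matrix.fromBlocks (Matrix.diagonal L)
      (Matrix.of fun j l => MvPolynomial.pderiv l (L j))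
      (Matrix.of fun i j => -MvPolynomial.C (b i j))
      (Matrix.of fun i l => MvPolynomial.pderiv l (p i)))
      = Matrix.fromBlocks (Matrix.diagonal fun j => MvPolynomial.eval x (L j))
      (Matrix.of fun j l => MvPolynomial.eval x (MvPolynomial.pderiv l (L j)))
      (Matrix.of fun i j => -b i j)
      (Matrix.of fun i l => MvPolynomial.eval x (MvPolynomial.pderiv l (p i))) := by
    ext (r | r) (c | c)
    · by_cases hrc : r = c <;> simp [hrc]
    all_goals simp
  rw [hmap]
  let _ : Invertible (Matrix.diagonal fun j => MvPolynomial.eval x (L j)) := by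
    refine Matrix.invertibleOfIsUnitDet _ ?_
    rw [Matrix.det_diagonal]
    exact isUnit_iff_ne_zero.2 (Finset.prod_ne_zero_iff.2 fun j _ => hx j)
  rw [Matrix.det_fromBlocks₁₁, Matrix.det_diagonal]
  congr 2
  have hinv : ⅟(Matrix.diagonal fun j => MvPolynomial.eval x (L j))
      = Matrix.diagonal fun j => (MvPolynomial.eval x (L j))⁻¹ := by
    refine invOf_eq_right_inv ?_
    rw [Matrix.diagonal_mul_diagonal, ← Matrix.diagonal_one]
    congr 1
    ext j
    exact mul_inv_cancel₀ (hx j)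
  rw [hinv]
  ext i l
  rw [Matrix.sub_apply, Matrix.mul_apply]
  simp only [Matrix.mul_diagonal, Matrix.of_apply, logPolyJacobian]
  simp only [neg_mul, Finset.sum_neg_distrib, mul_assoc]
  ring

theorem totalDegree_logPolyDet_le [DecidableEq ι] (L : ι → MvPolynomial (Fin K) ℝ)
    (b : Fin K → ι → ℝ)
    (p : Fin K → MvPolynomial (Fin K) ℝ) (I : Finset (Fin K)) (d : Fin K → ℕ) (D : ℕ)
    (hL : ∀ j, (L j).totalDegree ≤ 1) (hp : ∀ i ∈ I, p i = 0) (hb : ∀ i ∉ I, b i = 0)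
    (hpd : ∀ i ∉ I, (p i).totalDegree ≤ d i)
    (hD : Fintype.card ι + ∑ i ∈ Iᶜ, (d i - 1) ≤ D + I.card) :
    (logPolyDet L b p).totalDegree ≤ D := by
  have h := Matrix.totalDegree_det_le (Matrix.fromBlocks (Matrix.diagonal L)
      (Matrix.of fun j l => MvPolynomial.pderiv l (L j))
      (Matrix.of fun i j => -MvPolynomial.C (b i j))
      (Matrix.of fun i l => MvPolynomial.pderiv l (p i)))
      (Sum.elim (fun _ => 0) (fun i => if i ∈ I then -1 else ((d i - 1 : ℕ) : ℤ)))
      (Sum.elim (fun _ => 1) (fun _ => 0)) ?_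
  · rcases h with h | h
    · rw [logPolyDet, h]; simp
    · rw [logPolyDet]
      simp only [Fintype.sum_sum_type, Sum.elim_inl, Sum.elim_inr, Finset.sum_const_zero,
        Finset.sum_ite, Finset.sum_const, Finset.filter_mem_eq_inter, Finset.univ_inter] at h
      have h2 : (Finset.univ.filter fun i => i ∉ I) = Iᶜ := by ext; simp
      rw [h2] at h
      simp at h
      zify at hD ⊢
      have h3 : ∑ i ∈ Iᶜ, ((d i - 1 : ℕ) : ℤ) = ((∑ i ∈ Iᶜ, (d i - 1) : ℕ) : ℤ) := by push_cast; rfl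
      zify at h3
      linarith
  · rintro (r | r) (c | c)
    · by_cases hrc : r = c
      · subst hrc; right; simpa using hL r
      · left; simp [hrc]
    · right
      have := ((L r).totalDegree_pderiv_le c).trans (Nat.sub_le_sub_right (hL r) 1)
      simpa using this
    · by_cases hr : r ∈ I
      · right; simp [hr]
      · left; simp [hb r hr]
    · by_cases hr : r ∈ I
      · left; simp [hp r hr]
      · right
        have := ((p r).totalDegree_pderiv_le c).trans (Nat.sub_le_sub_right (hpd r hr) 1)
        simpa [hr] using this

end LogPoly

theorem le_of_forall_eventually_le {F : ℝ → ℕ} {t₀ t₁ : ℝ} (h01 : t₀ ≤ t₁)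
    (hr : ∀ t, ∀ᶠ u in 𝓝[>] t, F t ≤ F u)
    (hl : ∀ t, t₀ < t → ∀ᶠ u in 𝓝[<] t, F u ≤ F t) : F t₀ ≤ F t₁ := by
  set P : Set ℝ := {t | t ∈ Set.Icc t₀ t₁ ∧ ∀ u ∈ Set.Icc t₀ t, F t₀ ≤ F u} with hP
  have h0 : t₀ ∈ P := ⟨⟨le_rfl, h01⟩, fun u hu => by rw [le_antisymm hu.2 hu.1]⟩
  have hbdd : BddAbove P := ⟨t₁, fun t ht => ht.1.2⟩
  set s := sSup P with hs
  have hs0 : t₀ ≤ s := le_csSup hbdd h0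
  have hs1 : s ≤ t₁ := csSup_le ⟨t₀, h0⟩ fun t ht => ht.1.2
  have hlt : ∀ u, t₀ ≤ u → u < s → F t₀ ≤ F u := by
    intro u hu hus
    obtain ⟨t, ht, hut⟩ := exists_lt_of_lt_csSup ⟨t₀, h0⟩ hus
    exact ht.2 u ⟨hu, hut.le⟩
  have hFs : F t₀ ≤ F s := by
    rcases hs0.eq_or_lt with h | h
    · rw [← h]
    · have h1 : ∀ᶠ u in 𝓝[<] s, t₀ < u := eventually_nhdsWithin_of_eventually_nhds
        (lt_mem_nhds h)
      obtain ⟨u, hu1, hu2, hu3⟩ := ((hl s h).and (h1.and self_mem_nhdsWithin)).exists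
      exact (hlt u hu2.le hu3).trans hu1
  rcases hs1.eq_or_lt with h | h
  · rwa [← h]
  · exfalso
    obtain ⟨u, hu, hu2⟩ := (mem_nhdsGT_iff_exists_Ioo_subset' h).1 (hr s)
    have hmin : s < min u t₁ := lt_min hu h
    obtain ⟨m, hm1, hm2⟩ := exists_between hmin
    have : m ∈ P := by
      refine ⟨⟨hs0.trans hm1.le, hm2.le.trans (min_le_right _ _)⟩, fun v hv => ?_⟩
      rcases lt_trichotomy v s with h' | h' | h'
      · exact hlt v hv.1 h'
      · rwa [h']
      · exact hFs.trans (hu2 ⟨h', (hv.2.trans_lt hm2).trans_le (min_le_left _ _)⟩)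
    exact absurd (le_csSup hbdd this) (not_le.2 hm1)

/-- Let `g` be locally injective on a compact set `A` and a local surjection near the points of
`A ∩ O`, where `A \ O` is finite. Following the points of a fibre of `g` upwards until they leave
`O` shows that the fibre over `t₀` has at most as many points in `O` as there are points of
`A \ O` above it. -/
theorem card_fiber_le_of_isCompact {E : Type*} [TopologicalSpace E] [T2Space E] {A O : Set E}
    {g : E → ℝ} (hA : IsCompact A) (hg : ContinuousOn g A)
    (hinj : ∀ x ∈ A, ∃ U ∈ 𝓝 x, Set.InjOn g (A ∩ U))
    (hopen : ∀ x ∈ A ∩ O, ∀ U ∈ 𝓝 x, ∀ᶠ t in 𝓝 (g x), ∃ y ∈ U ∩ (A ∩ O), g y = t)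
    (B : Finset E) (hB : (B : Set E) = A \ O) (t₀ : ℝ) (S : Finset E)
    (hS : ∀ x ∈ S, x ∈ A ∩ O ∧ g x = t₀) :
    S.card ≤ (B.filter fun x => t₀ ≤ g x).card := by
  classical
  have hfin : ∀ t, {x ∈ A | g x = t}.Finite := by
    intro t
    choose! U hU hUi using hinj
    obtain ⟨c, hc, hcov⟩ := hA.elim_nhds_subcover U hU
    have : {x ∈ A | g x = t} ⊆ ⋃ y ∈ c, {x ∈ A ∩ U y | g x = t} := by
      intro x hx
      obtain ⟨y, hy, hxy⟩ := Set.mem_iUnion₂.1 (hcov hx.1)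
      exact Set.mem_iUnion₂.2 ⟨y, hy, ⟨hx.1, hxy⟩, hx.2⟩
    refine (c.finite_toSet.biUnion fun y hy => ?_).subset this
    refine Set.Subsingleton.finite fun u hu v hv => ?_
    exact hUi y (hc y hy) hu.1 hv.1 (hu.2.trans hv.2.symm)
  let n : ℝ → ℕ := fun t => {x ∈ A ∩ O | g x = t}.ncard
  have hfinO : ∀ t, {x ∈ A ∩ O | g x = t}.Finite := fun t =>
    (hfin t).subset fun x hx => ⟨hx.1.1, hx.2⟩
  let F : ℝ → ℕ := fun t => n t + (B.filter fun x => t₀ ≤ g x ∧ g x ≤ t).card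
  have hr : ∀ t, ∀ᶠ u in 𝓝[>] t, F t ≤ F u := by
    intro t
    obtain ⟨U, hU, hdisj⟩ := (hfinO t).t2_separation
    have h1 : ∀ᶠ u in 𝓝 t, ∀ x ∈ {x ∈ A ∩ O | g x = t}, ∃ y ∈ U x ∩ (A ∩ O), g y = u := by
      refine (eventually_all_finite (hfinO t)).2 fun x hx => ?_
      have := hopen x hx.1 (U x) ((hU x).2.mem_nhds (hU x).1)
      rwa [hx.2] at this
    filter_upwards [eventually_nhdsWithin_of_eventually_nhds h1, self_mem_nhdsWithin] with u hu htu
    refine Nat.add_le_add ?_ (Finset.card_le_card fun x hx => ?_)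
    · choose! y hy hyu using hu
      refine Set.ncard_le_ncard_of_injOn y (fun x hx => ⟨(hy x hx).2, hyu x hx⟩) ?_ (hfinO u)
      intro a ha b hb hab
      by_contra hne
      have := hdisj ha hb hne
      exact Set.disjoint_left.1 this (hy a ha).1 (hab ▸ (hy b hb).1)
    · simp only [Finset.mem_filter] at hx ⊢
      exact ⟨hx.1, hx.2.1, hx.2.2.trans (le_of_lt htu)⟩
  have hl : ∀ t, t₀ < t → ∀ᶠ u in 𝓝[<] t, F u ≤ F t := by
    intro t htt
    choose! U hU hUi using hinj
    let W : Set E := ⋃ x ∈ {x ∈ A | g x = t}, interior (U x)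
    have hW : IsOpen W := isOpen_biUnion fun _ _ => isOpen_interior
    have hcomp : IsCompact (g '' (A \ W)) :=
      (hA.diff hW).image_of_continuousOn (hg.mono Set.sdiff_subset)
    have hnot : t ∉ g '' (A \ W) := by
      rintro ⟨x, hx, hxt⟩
      exact hx.2 (Set.mem_iUnion₂.2 ⟨x, ⟨hx.1, hxt⟩, mem_interior_iff_mem_nhds.2 (hU x hx.1)⟩)
    have h1 : ∀ᶠ u in 𝓝 t, u ∉ g '' (A \ W) := hcomp.isClosed.isOpen_compl.mem_nhds hnot
    filter_upwards [eventually_nhdsWithin_of_eventually_nhds h1, self_mem_nhdsWithin] with u hu hut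
    have hcov : ∀ x, x ∈ A ∧ g x = u → ∃ y, (y ∈ A ∧ g y = t) ∧ x ∈ U y := by
      intro x hx
      by_contra hno
      push Not at hno
      refine hu ⟨x, ⟨hx.1, fun hxW => ?_⟩, hx.2⟩
      obtain ⟨y, hy, hxy⟩ := Set.mem_iUnion₂.1 hxW
      exact hno y hy (interior_subset hxy)
    choose! y hy hxy using hcov
    have h2 : {x ∈ A | g x = u}.ncard ≤ {x ∈ A | g x = t}.ncard := by
      refine Set.ncard_le_ncard_of_injOn y (fun x hx => hy x hx) ?_ (hfin t)
      intro a ha b hb hab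
      refine hUi (y a) (hy a ha).1 ⟨ha.1, hxy a ha⟩ ⟨hb.1, hab ▸ hxy b hb⟩ (ha.2.trans hb.2.symm)
    have h3 : n u ≤ {x ∈ A | g x = u}.ncard :=
      Set.ncard_le_ncard (fun x hx => ⟨hx.1.1, hx.2⟩) (hfin u)
    have h4 : {x ∈ A | g x = t}.ncard ≤ n t + (B.filter fun x => g x = t).card := by
      rw [← Set.ncard_coe_finset]
      refine (Set.ncard_le_ncard ?_ ((hfinO t).union (Finset.finite_toSet _))).trans
        (Set.ncard_union_le _ _)
      intro x hx
      by_cases hxO : x ∈ O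
      · exact Or.inl ⟨⟨hx.1, hxO⟩, hx.2⟩
      · refine Or.inr ?_
        have : x ∈ (B : Set E) := hB ▸ ⟨hx.1, hxO⟩
        simpa [hx.2] using this
    have h5 : (B.filter fun x => t₀ ≤ g x ∧ g x ≤ u).card + (B.filter fun x => g x = t).card
        ≤ (B.filter fun x => t₀ ≤ g x ∧ g x ≤ t).card := by
      rw [← Finset.card_union_of_disjoint]
      · refine Finset.card_le_card fun x hx => ?_
        have hut' : u < t := hut
        simp only [Finset.mem_union, Finset.mem_filter] at hx ⊢
        rcases hx with ⟨h, h', h''⟩ | ⟨h, h'⟩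
        · exact ⟨h, h', by linarith⟩
        · exact ⟨h, by linarith, by linarith⟩
      · rw [Finset.disjoint_filter]
        rintro x - ⟨-, h⟩ h'
        have hut' : u < t := hut
        linarith
    simp only [F]
    omega
  obtain ⟨M, hM⟩ : ∃ M, ∀ x ∈ A, g x < M := by
    obtain ⟨M, hM⟩ := (hA.image_of_continuousOn hg).bddAbove
    exact ⟨M + 1, fun x hx => by linarith [hM ⟨x, hx, rfl⟩]⟩
  have hmain := le_of_forall_eventually_le (F := F) (le_max_left t₀ M) hr hl
  have hn1 : n (max t₀ M) = 0 := by
    have : {x ∈ A ∩ O | g x = max t₀ M} = ∅ := by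
      ext x
      simp only [Set.mem_ofPred_eq, Set.mem_empty_iff_false, iff_false, not_and]
      intro hx h
      have := hM x hx.1
      have := le_max_right t₀ M
      linarith
    change ({x | x ∈ A ∩ O ∧ g x = max t₀ M}).ncard = 0
    rw [this, Set.ncard_empty]
  have h1 : S.card ≤ n t₀ := by
    rw [← Set.ncard_coe_finset]
    exact Set.ncard_le_ncard (fun x hx => hS x hx) (hfinO t₀)
  calc S.card ≤ F t₀ := h1.trans (Nat.le_add_right _ _)
    _ ≤ F (max t₀ M) := hmain
    _ ≤ _ := by
      simp only [F, hn1, zero_add]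
      exact Finset.card_le_card fun x hx => by
        simp only [Finset.mem_filter] at hx ⊢
        exact ⟨hx.1, hx.2.1⟩

theorem eventually_exists_mem_eq_of_map_nhds {X Y : Type*} [TopologicalSpace X]
    [TopologicalSpace Y] {f : X → Y} {y : Y} (S : Finset X) (U : X → Set X)
    (hU : ∀ x ∈ S, U x ∈ 𝓝 x) (hf : ∀ x ∈ S, Filter.map f (𝓝 x) = 𝓝 y) :
    ∀ᶠ z in 𝓝 y, ∀ x ∈ S, ∃ w ∈ U x, f w = z := by
  refine (Finset.eventually_all S).2 fun x hx => ?_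
  rw [← hf x hx]
  have : f '' (U x) ∈ Filter.map f (𝓝 x) := image_mem_map (hU x hx)
  filter_upwards [this] with z hz
  obtain ⟨w, hw, rfl⟩ := hz
  exact ⟨w, hw, rfl⟩

theorem card_le_prod_of_det_ne_zero {K : ℕ} (d : Fin K → ℕ)
    (p : Fin K → MvPolynomial (Fin K) ℝ) (hp : ∀ i, (p i).totalDegree ≤ d i)
    (c : Fin K → ℝ) (S : Finset (Fin K → ℝ))
    (hS : ∀ x ∈ S, ∀ i, MvPolynomial.eval x (p i) = c i)
    (hdet : ∀ x ∈ S, (Matrix.of fun i l =>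
      MvPolynomial.eval x (MvPolynomial.pderiv l (p i))).det ≠ 0) :
    S.card ≤ ∏ i, d i := by
  classical
  have hbad := finite_bad_parameters_bezout d (fun i => p i - MvPolynomial.C (c i)) fun i =>
    (MvPolynomial.totalDegree_sub _ _).trans (by simpa using hp i)
  let Ψ : (Fin K → ℝ) × ℝ → (Fin K → ℝ) × ℝ := fun z =>
    (fun i => MvPolynomial.eval z.1 (p i) + z.2 * z.1 i ^ d i, z.2)
  have hmap : ∀ x ∈ S, Filter.map Ψ (𝓝 (x, 0)) = 𝓝 (c, 0) := by
    intro x hx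
    set J : Matrix (Fin K) (Fin K) ℝ := Matrix.of fun i l =>
      MvPolynomial.eval x (MvPolynomial.pderiv l (p i)) with hJ
    have h1 : HasStrictFDerivAt Ψ
        (((((LinearMap.toContinuousLinearMap (Matrix.toLin' J))).comp
          (ContinuousLinearMap.fst ℝ (Fin K → ℝ) ℝ)) +
          (ContinuousLinearMap.snd ℝ (Fin K → ℝ) ℝ).smulRight (fun i => x i ^ d i)).prod
          (ContinuousLinearMap.snd ℝ (Fin K → ℝ) ℝ)) (x, 0) := by
      refine HasStrictFDerivAt.prodMk ?_ hasStrictFDerivAt_snd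
      rw [hasStrictFDerivAt_pi']
      intro i
      have h2 : HasStrictFDerivAt (fun z : (Fin K → ℝ) × ℝ => MvPolynomial.eval z.1 (p i)) _
        (x, (0 : ℝ)) := HasStrictFDerivAt.comp (g := fun y => MvPolynomial.eval y (p i)) (x, (0 : ℝ))
          ((p i).hasStrictFDerivAt_eval x)
          hasStrictFDerivAt_fst
      have h3 : HasStrictFDerivAt (fun z : (Fin K → ℝ) × ℝ => z.1 i) _ (x, (0 : ℝ)) :=
        HasStrictFDerivAt.comp (g := fun y : Fin K → ℝ => y i) (x, (0 : ℝ))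
          (hasStrictFDerivAt_apply (𝕜 := ℝ) (F' := fun _ : Fin K => ℝ) i x) hasStrictFDerivAt_fst
      have h4 : HasStrictFDerivAt (fun z : (Fin K → ℝ) × ℝ => z.2) _ (x, (0 : ℝ)) :=
        hasStrictFDerivAt_snd (𝕜 := ℝ)
      refine (h2.add (h4.mul (h3.pow (d i)))).congr_fderiv ?_
      ext v
      all_goals
        simp [Matrix.toLin'_apply, Matrix.mulVec, dotProduct, J]
    have h2 := h1.map_nhds_eq_of_surj ?_
    · rw [h2]
      congr 1
      simp only [Ψ]
      congr 1
      ext i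
      simp [hS x hx i]
    · rw [LinearMap.range_eq_top]
      rintro ⟨v, t⟩
      obtain ⟨w, hw⟩ : ∃ w, J.mulVec w = v - t • fun i => x i ^ d i := by
        refine ⟨J⁻¹.mulVec (v - t • fun i => x i ^ d i), ?_⟩
        rw [Matrix.mulVec_mulVec, Matrix.mul_nonsing_inv _ (isUnit_iff_ne_zero.2 (hdet x hx)),
          Matrix.one_mulVec]
      refine ⟨(w, t), ?_⟩
      simp [Matrix.toLin'_apply, hw]
  obtain ⟨U, hU, hdisj⟩ := (S.finite_toSet).t2_separation
  have hev := eventually_exists_mem_eq_of_map_nhds (f := Ψ) (y := (c, (0 : ℝ)))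
    (S.map ⟨fun x => (x, (0 : ℝ)), fun a b h => (Prod.mk.inj h).1⟩)
    (fun z => U z.1 ×ˢ Set.univ) (fun z hz => ?_) (fun z hz => ?_)
  · have h5 : Tendsto (fun s : ℝ => ((c, s⁻¹) : (Fin K → ℝ) × ℝ)) atTop (𝓝 (c, 0)) :=
      (tendsto_const_nhds).prodMk_nhds tendsto_inv_atTop_zero
    have h6 : ∀ᶠ s : ℝ in atTop, s ∉ {s : ℝ | ∃ S : Finset (Fin K → ℝ), ∏ i, d i < S.card ∧
        ∀ x ∈ S, ∀ i, x i ^ d i + s * MvPolynomial.eval x (p i - MvPolynomial.C (c i)) = 0} := by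
      obtain ⟨M, hM⟩ := hbad.bddAbove
      filter_upwards [eventually_gt_atTop M] with s hs hs2
      exact absurd (hM hs2) (not_le.2 hs)
    obtain ⟨s, hs1, hs2, hs3⟩ := ((h5.eventually hev).and
      (h6.and (eventually_gt_atTop (0 : ℝ)))).exists
    have hs1' : ∀ x ∈ S, ∃ y ∈ U x, ∀ i, y i ^ d i + s * MvPolynomial.eval y
        (p i - MvPolynomial.C (c i)) = 0 := by
      intro x hx
      obtain ⟨⟨y, ε⟩, hy, hy2⟩ := hs1 (x, 0) (Finset.mem_map.2 ⟨x, hx, rfl⟩)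
      simp only [Ψ, Prod.mk.injEq] at hy2
      obtain ⟨hy3, rfl⟩ := hy2
      refine ⟨y, hy.1, fun i => ?_⟩
      have := congrFun hy3 i
      rw [map_sub, MvPolynomial.eval_C, ← this]
      field_simp
      ring
    choose! y hy hy2 using hs1'
    by_contra hlt
    refine hs2 ⟨S.image y, ?_, ?_⟩
    · rw [Finset.card_image_of_injOn]
      · exact not_le.1 hlt
      · intro a ha b hb hab
        by_contra hne
        exact Set.disjoint_left.1 (hdisj ha hb hne) (hy a ha) (hab ▸ hy b hb)
    · intro x hx
      obtain ⟨a, ha, rfl⟩ := Finset.mem_image.1 hx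
      exact hy2 a ha
  · obtain ⟨x, hx, rfl⟩ := Finset.mem_map.1 hz
    exact prod_mem_nhds ((hU x).2.mem_nhds (hU x).1) univ_mem
  · obtain ⟨x, hx, rfl⟩ := Finset.mem_map.1 hz
    exact hmap x hx

theorem two_mul_card_fiber_le {E ρ α : Type*} [TopologicalSpace E] [T2Space E] [DecidableEq ρ]
    [Finite α] {Φ : E → ρ → ℝ} {i₀ : ρ} {φ : α → E → ℝ} {s t : ℝ} {c : ρ → ℝ}
    (hφ : ∀ a, Continuous (φ a)) (hcomp : IsCompact {x | ∀ a, s ≤ φ a x})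
    (hmap : ∀ x, (∀ a, s ≤ φ a x) → Filter.map Φ (𝓝 x) = 𝓝 (Φ x))
    (hinj : ∀ x, (∀ a, s ≤ φ a x) → ∃ U ∈ 𝓝 x, Set.InjOn Φ U)
    (B : Finset E) (hB : ∀ x, x ∈ B ↔
      (∀ a, s ≤ φ a x) ∧ (∃ a, φ a x = s) ∧ ∀ i, i ≠ i₀ → Φ x i = c i)
    (hBt : ∀ x ∈ B, Φ x i₀ ≠ t) (S : Finset E)
    (hS : ∀ x ∈ S, (∀ a, s < φ a x) ∧ (∀ i, i ≠ i₀ → Φ x i = c i) ∧ Φ x i₀ = t) :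
    2 * S.card ≤ B.card := by
  classical
  set A : Set E := {x | ∀ a, s ≤ φ a x} ∩ Φ ⁻¹' {y | ∀ i, i ≠ i₀ → y i = c i} with hAdef
  set O : Set E := {x | ∀ a, s < φ a x} with hO
  have hcont : ∀ x ∈ {x | ∀ a, s ≤ φ a x}, ContinuousAt Φ x := fun x hx => (hmap x hx).le
  have hA : IsCompact A := by
    refine hcomp.of_isClosed_subset ?_ Set.inter_subset_left
    refine ContinuousOn.preimage_isClosed_of_isClosed
      (fun x hx => (hcont x hx).continuousWithinAt) hcomp.isClosed ?_
    have : {y : ρ → ℝ | ∀ i, i ≠ i₀ → y i = c i} = ⋂ i, ⋂ (_ : i ≠ i₀), {y | y i = c i} := by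
      ext; simp
    rw [this]
    exact isClosed_iInter fun i => isClosed_iInter fun _ =>
      isClosed_eq (continuous_apply i) continuous_const
  have hOo : IsOpen O := by
    have : O = ⋂ a, {x | s < φ a x} := by ext; simp [hO]
    rw [this]
    exact isOpen_iInter_of_finite fun a => isOpen_lt continuous_const (hφ a)
  have hBA : (B : Set E) = A \ O := by
    ext x
    rw [Finset.mem_coe, hB]
    simp only [hAdef, hO, Set.mem_sdiff, Set.mem_inter_iff, Set.mem_ofPred_eq, Set.mem_preimage,
      not_forall, not_lt]
    constructor
    · rintro ⟨h1, ⟨a, h2⟩, h3⟩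
      exact ⟨⟨h1, h3⟩, a, h2.le⟩
    · rintro ⟨⟨h1, h3⟩, a, h2⟩
      exact ⟨h1, ⟨a, le_antisymm h2 (h1 a)⟩, h3⟩
  have hg : ContinuousOn (fun x => Φ x i₀) A := fun x hx =>
    ((continuous_apply i₀).continuousAt.comp (hcont x hx.1)).continuousWithinAt
  have hginj : ∀ x ∈ A, ∃ U ∈ 𝓝 x, Set.InjOn (fun x => Φ x i₀) (A ∩ U) := by
    intro x hx
    obtain ⟨U, hU, hUi⟩ := hinj x hx.1
    refine ⟨U, hU, fun y hy z hz hyz => hUi hy.2 hz.2 ?_⟩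
    ext i
    by_cases hi : i = i₀
    · subst hi; exact hyz
    · rw [hy.1.2 i hi, hz.1.2 i hi]
  have hgopen : ∀ x ∈ A ∩ O, ∀ U ∈ 𝓝 x, ∀ᶠ u in 𝓝 (Φ x i₀),
      ∃ y ∈ U ∩ (A ∩ O), Φ y i₀ = u := by
    intro x hx U hU
    have h1 : Φ '' (U ∩ O) ∈ 𝓝 (Φ x) := by
      rw [← hmap x hx.1.1]
      exact image_mem_map (inter_mem hU (hOo.mem_nhds hx.2))
    have h2 : Tendsto (fun u => Function.update (Φ x) i₀ u) (𝓝 (Φ x i₀)) (𝓝 (Φ x)) := by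
      have : Continuous fun u => Function.update (Φ x) i₀ u :=
        continuous_const.update i₀ continuous_id
      have h3 := this.tendsto (Φ x i₀)
      rwa [Function.update_eq_self] at h3
    filter_upwards [h2 h1] with u hu
    obtain ⟨y, hy, hyu : Φ y = Function.update (Φ x) i₀ u⟩ := hu
    refine ⟨y, ⟨hy.1, ⟨fun a => (hy.2 a).le, fun i hi => ?_⟩, hy.2⟩, ?_⟩
    · rw [hyu, Function.update_of_ne hi, hx.1.2 i hi]
    · rw [hyu, Function.update_self]
  have key1 := card_fiber_le_of_isCompact hA hg hginj hgopen B hBA t S fun x hx =>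
    ⟨⟨⟨fun a => ((hS x hx).1 a).le, (hS x hx).2.1⟩, (hS x hx).1⟩, (hS x hx).2.2⟩
  have key2 := card_fiber_le_of_isCompact (g := fun x => -Φ x i₀) hA hg.neg
    (fun x hx => by
      obtain ⟨U, hU, hUi⟩ := hginj x hx
      exact ⟨U, hU, fun y hy z hz hyz => hUi hy hz (neg_injective hyz)⟩)
    (fun x hx U hU => by
      have h := (continuous_neg.tendsto (-Φ x i₀))
      rw [neg_neg] at h
      filter_upwards [h.eventually (hgopen x hx U hU)] with u hu
      obtain ⟨y, hy, hyu⟩ := hu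
      exact ⟨y, hy, by rw [hyu, neg_neg]⟩) B hBA (-t) S fun x hx =>
    ⟨⟨⟨fun a => ((hS x hx).1 a).le, (hS x hx).2.1⟩, (hS x hx).1⟩, by rw [(hS x hx).2.2]⟩
  have hdisj : Disjoint (B.filter fun x => t ≤ Φ x i₀) (B.filter fun x => -t ≤ -Φ x i₀) := by
    rw [Finset.disjoint_filter]
    intro x hx h1 h2
    exact hBt x hx (le_antisymm (neg_le_neg_iff.1 h2) h1)
  have := Finset.card_union_of_disjoint hdisj
  have h3 := Finset.card_le_card (Finset.union_subset (Finset.filter_subset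
    (fun x => t ≤ Φ x i₀) B) (Finset.filter_subset (fun x => -t ≤ -Φ x i₀) B))
  omega

theorem exists_mem_notMem_of_isOpen {ρ α : Type*} [Fintype ρ] [Finite α] {U : Set (ρ → ℝ)}
    (hU : IsOpen U) (hne : U.Nonempty) (Z : α → Set (ρ → ℝ))
    (hZ : ∀ a, MeasureTheory.volume (Z a) = 0) : ∃ x ∈ U, ∀ a, x ∉ Z a := by
  have h1 : MeasureTheory.volume (⋃ a, Z a) = 0 := MeasureTheory.measure_iUnion_null hZ
  have h2 : MeasureTheory.volume U ≠ 0 := (hU.measure_pos _ hne).ne'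
  by_contra! hno
  refine h2 (MeasureTheory.measure_mono_null (fun x hx => ?_) h1)
  obtain ⟨a, ha⟩ := hno x hx
  exact Set.mem_iUnion.2 ⟨a, ha⟩

section LogPoly

variable {K : ℕ} {ι : Type*} [Fintype ι]

theorem volume_critical_values_logPolyMap (L : ι → MvPolynomial (Fin K) ℝ) (b : Fin K → ι → ℝ)
    (p : Fin K → MvPolynomial (Fin K) ℝ) :
    MeasureTheory.volume (logPolyMap L b p '' {x | (∀ j, 0 < MvPolynomial.eval x (L j)) ∧
      (logPolyJacobian L b p x).det = 0}) = 0 := by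
  refine MeasureTheory.addHaar_image_eq_zero_of_det_fderivWithin_eq_zero MeasureTheory.volume
    (fun x hx => ((hasStrictFDerivAt_logPolyMap L b p x
      fun j => (hx.1 j).ne').hasFDerivAt).hasFDerivWithinAt) fun x hx => ?_
  rw [LinearMap.det_toContinuousLinearMap, LinearMap.det_toLin']
  exact hx.2

theorem exists_equiv_hasStrictFDerivAt_logPolyMap (L : ι → MvPolynomial (Fin K) ℝ)
    (b : Fin K → ι → ℝ) (p : Fin K → MvPolynomial (Fin K) ℝ) (x : Fin K → ℝ)
    (hx : ∀ j, 0 < MvPolynomial.eval x (L j)) (hdet : (logPolyJacobian L b p x).det ≠ 0) :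
    ∃ e : (Fin K → ℝ) ≃L[ℝ] (Fin K → ℝ), HasStrictFDerivAt (logPolyMap L b p)
      (e : (Fin K → ℝ) →L[ℝ] (Fin K → ℝ)) x := by
  have h := hasStrictFDerivAt_logPolyMap L b p x fun j => (hx j).ne'
  have hu : IsUnit (LinearMap.det (Matrix.toLin' (logPolyJacobian L b p x))) := by
    rw [LinearMap.det_toLin']
    exact isUnit_iff_ne_zero.2 hdet
  refine ⟨(LinearEquiv.ofIsUnitDet (v := Pi.basisFun ℝ (Fin K)) (v' := Pi.basisFun ℝ (Fin K))
    (f := Matrix.toLin' (logPolyJacobian L b p x)) ?_).toContinuousLinearEquiv, ?_⟩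
  · rw [LinearMap.det_toMatrix]
    exact hu
  · convert h
    ext v : 1
    rfl

theorem map_nhds_logPolyMap (L : ι → MvPolynomial (Fin K) ℝ)
    (b : Fin K → ι → ℝ) (p : Fin K → MvPolynomial (Fin K) ℝ) (x : Fin K → ℝ)
    (hx : ∀ j, 0 < MvPolynomial.eval x (L j)) (hdet : (logPolyJacobian L b p x).det ≠ 0) :
    Filter.map (logPolyMap L b p) (𝓝 x) = 𝓝 (logPolyMap L b p x) := by
  obtain ⟨e, he⟩ := exists_equiv_hasStrictFDerivAt_logPolyMap L b p x hx hdet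
  exact he.map_nhds_eq_of_equiv

theorem exists_injOn_logPolyMap (L : ι → MvPolynomial (Fin K) ℝ)
    (b : Fin K → ι → ℝ) (p : Fin K → MvPolynomial (Fin K) ℝ) (x : Fin K → ℝ)
    (hx : ∀ j, 0 < MvPolynomial.eval x (L j)) (hdet : (logPolyJacobian L b p x).det ≠ 0) :
    ∃ U ∈ 𝓝 x, Set.InjOn (logPolyMap L b p) U := by
  obtain ⟨e, he⟩ := exists_equiv_hasStrictFDerivAt_logPolyMap L b p x hx hdet
  exact ⟨_, (he.toOpenPartialHomeomorph _).open_source.mem_nhds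
    he.mem_toOpenPartialHomeomorph_source, (he.toOpenPartialHomeomorph _).injOn⟩

end LogPoly

theorem Set.exists_finset_eq_card_le {E : Type*} {A : Set E} {B : ℝ}
    (h : ∀ S : Finset E, (S : Set E) ⊆ A → (S.card : ℝ) ≤ B) :
    ∃ T : Finset E, (T : Set E) = A ∧ (T.card : ℝ) ≤ B := by
  have hfin : A.Finite := by
    by_contra hinf
    obtain ⟨m, hm⟩ := exists_nat_gt B
    obtain ⟨S, hS, hSc⟩ := Set.Infinite.exists_subset_card_eq hinf m
    have := h S hS
    rw [hSc] at this
    linarith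
  exact ⟨hfin.toFinset, hfin.coe_toFinset, h _ (by rw [hfin.coe_toFinset])⟩

/-- The recursive bound coming from Rolle's theorem, where `F` is the number of faces. -/
noncomputable def rolleBound (F : ℕ) : ℕ → ℕ → ℝ
  | 0, _ => 1
  | r + 1, D => D * rolleBound F r (2 * D) + F / 2 * rolleBound F r (D + 1)

section LogPoly

variable {K : ℕ} {ι : Type*} [Fintype ι]

theorem logPolyMap_update_eq_iff (L : ι → MvPolynomial (Fin K) ℝ) (b : Fin K → ι → ℝ)
    (p : Fin K → MvPolynomial (Fin K) ℝ) (i₀ : Fin K) (q : MvPolynomial (Fin K) ℝ)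
    (x y : Fin K → ℝ) :
    logPolyMap L (Function.update b i₀ 0) (Function.update p i₀ q) x = y ↔
      (∀ i, i ≠ i₀ → logPolyMap L b p x i = y i) ∧ MvPolynomial.eval x q = y i₀ := by
  rw [funext_iff]
  constructor
  · refine fun h => ⟨fun i hi => ?_, ?_⟩
    · rw [← h i]
      simp [logPolyMap, Function.update_of_ne hi]
    · rw [← h i₀]
      simp [logPolyMap]
  · rintro ⟨h1, h2⟩ i
    by_cases hi : i = i₀
    · subst hi
      rw [← h2]
      simp [logPolyMap]
    · rw [← h1 i hi]
      simp [logPolyMap, Function.update_of_ne hi]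

theorem exists_perturbed_fiber (L : ι → MvPolynomial (Fin K) ℝ) (b : Fin K → ι → ℝ)
    (p : Fin K → MvPolynomial (Fin K) ℝ) (σ J : MvPolynomial (Fin K) ℝ)
    (i₀ : Fin K) (c : Fin K → ℝ) (S : Finset (Fin K → ℝ))
    (hS : ∀ x ∈ S, (∀ j, 0 < MvPolynomial.eval x (L j)) ∧ logPolyMap L b p x = c ∧
      (logPolyJacobian L b p x).det ≠ 0 ∧ MvPolynomial.eval x J ≠ 0)
    (R : ℝ) (hR : ∀ x ∈ S, MvPolynomial.eval x σ < R) {α : Type*} [Finite α]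
    (Z : α → Set (Fin K → ℝ)) (hZ : ∀ a, MeasureTheory.volume (Z a) = 0) :
    ∃ y : Fin K → ℝ, 0 < y i₀ ∧ (∀ a, y ∉ Z a) ∧
      ∀ V : Set ℝ, V.Finite → ∃ t ∉ V, ∃ S' : Finset (Fin K → ℝ), S'.card = S.card ∧
        ∀ x ∈ S', (∀ j, y i₀ < MvPolynomial.eval x (L j)) ∧ y i₀ < R - MvPolynomial.eval x σ ∧
          y i₀ < |MvPolynomial.eval x J| ∧
          (∀ i, i ≠ i₀ → logPolyMap L b p x i = y i) ∧ logPolyMap L b p x i₀ = t := by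
  classical
  have hev : ∀ {r : ℝ}, 0 < r → ∀ᶠ s in 𝓝[>] (0 : ℝ), s < r := fun hr =>
    eventually_nhdsWithin_of_eventually_nhds (gt_mem_nhds hr)
  have h1 : ∀ᶠ s in 𝓝[>] (0 : ℝ), ∀ x ∈ S, (∀ j, s < MvPolynomial.eval x (L j)) ∧
      s < R - MvPolynomial.eval x σ ∧ s < |MvPolynomial.eval x J| := by
    refine (Finset.eventually_all S).2 fun x hx => ?_
    refine (eventually_all.2 fun j => hev ((hS x hx).1 j)).and ((hev ?_).and (hev ?_))
    · linarith [hR x hx]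
    · exact abs_pos.2 (hS x hx).2.2.2
  obtain ⟨s, hs, hs0⟩ := (h1.and self_mem_nhdsWithin).exists
  replace hs0 : 0 < s := hs0
  obtain ⟨V, hV, hVd⟩ := (S.finite_toSet).t2_separation
  let O : Set (Fin K → ℝ) := {x | (∀ j, s < MvPolynomial.eval x (L j)) ∧
      s < R - MvPolynomial.eval x σ ∧ s < |MvPolynomial.eval x J|}
  have hcont : ∀ q : MvPolynomial (Fin K) ℝ, Continuous fun x => MvPolynomial.eval x q :=
    fun q => MvPolynomial.continuous_eval q
  have hO : IsOpen O := by
    refine IsOpen.inter ?_ (IsOpen.inter ?_ ?_)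
    · have : {x | ∀ j, s < MvPolynomial.eval x (L j)} = ⋂ j, {x | s < MvPolynomial.eval x (L j)} := by
        ext; simp
      change IsOpen {x | ∀ j, s < MvPolynomial.eval x (L j)}
      rw [this]
      exact isOpen_iInter_of_finite fun j => isOpen_lt continuous_const (hcont _)
    · exact isOpen_lt continuous_const (continuous_const.sub (hcont _))
    · exact isOpen_lt continuous_const (hcont _).abs
  have h2 := eventually_exists_mem_eq_of_map_nhds (f := logPolyMap L b p) (y := c) S
    (fun x => V x ∩ O) (fun x hx => inter_mem ((hV x).2.mem_nhds (hV x).1) (hO.mem_nhds (hs x hx)))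
    fun x hx => by
      rw [map_nhds_logPolyMap L b p x (hS x hx).1 (hS x hx).2.2.1, (hS x hx).2.1]
  obtain ⟨N, hN, hNo, hcN⟩ := eventually_nhds_iff.1 h2
  let U : Set (Fin K → ℝ) := (fun y => Function.update y i₀ (c i₀)) ⁻¹' N ∩
    (fun y => y i₀) ⁻¹' Set.Ioo 0 s
  have hU : IsOpen U := (hNo.preimage (continuous_id.update i₀ continuous_const)).inter
    (isOpen_Ioo.preimage (continuous_apply i₀))
  have hUne : U.Nonempty := by
    refine ⟨Function.update c i₀ (s / 2), ?_, ?_⟩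
    · simpa using hcN
    · simp [hs0]
  obtain ⟨y, hyU, hyZ⟩ := exists_mem_notMem_of_isOpen hU hUne Z hZ
  refine ⟨y, hyU.2.1, hyZ, fun W hW => ?_⟩
  have h3 : {u | Function.update y i₀ u ∈ N} ∈ 𝓝 (c i₀) :=
    (hNo.preimage (continuous_const.update i₀ continuous_id)).mem_nhds hyU.1
  obtain ⟨t, htW, ht⟩ : ∃ t, t ∉ W ∧ Function.update y i₀ t ∈ N := by
    by_contra! hno
    refine infinite_of_mem_nhds (c i₀) h3 (hW.subset fun u hu => ?_)
    by_contra hu'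
    exact hno u hu' hu
  refine ⟨t, htW, ?_⟩
  have h4 := hN _ ht
  choose! w hw hwy using h4
  refine ⟨S.image w, Finset.card_image_of_injOn ?_, ?_⟩
  · intro a ha a' ha' haa
    by_contra hne
    exact Set.disjoint_left.1 (hVd ha ha' hne) (hw a ha).1 (haa ▸ (hw a' ha').1)
  · intro x hx
    obtain ⟨a, ha, rfl⟩ := Finset.mem_image.1 hx
    have h5 := (hw a ha).2
    have h6 : y i₀ < s := hyU.2.2
    refine ⟨fun j => h6.trans (h5.1 j), h6.trans h5.2.1, h6.trans h5.2.2, fun i hi => ?_, ?_⟩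
    · rw [hwy a ha, Function.update_of_ne hi]
    · rw [hwy a ha, Function.update_self]

theorem two_mul_card_le_of_face_sets [DecidableEq ι] (L : ι → MvPolynomial (Fin K) ℝ)
    (b : Fin K → ι → ℝ)
    (p : Fin K → MvPolynomial (Fin K) ℝ) (σ : MvPolynomial (Fin K) ℝ) (i₀ : Fin K)
    (hcomp : ∀ δ > 0, ∀ R, IsCompact {x | (∀ j, δ ≤ MvPolynomial.eval x (L j)) ∧
      MvPolynomial.eval x σ ≤ R})
    (R t : ℝ) (y : Fin K → ℝ) (hy : 0 < y i₀)
    (q : Bool ⊕ Option ι → MvPolynomial (Fin K) ℝ)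
    (hq : q = Sum.elim (fun e => if e then logPolyDet L b p else -logPolyDet L b p)
      (fun o => o.elim (MvPolynomial.C R - σ) L))
    (T : Bool ⊕ Option ι → Finset (Fin K → ℝ))
    (hT : ∀ a x, x ∈ T a ↔ (∀ j, 0 < MvPolynomial.eval x (L j)) ∧
      (∀ i, i ≠ i₀ → logPolyMap L b p x i = y i) ∧ MvPolynomial.eval x (q a) = y i₀)
    (ht : ∀ a, ∀ x ∈ T a, logPolyMap L b p x i₀ ≠ t)
    (S : Finset (Fin K → ℝ))
    (hS : ∀ x ∈ S, (∀ j, y i₀ < MvPolynomial.eval x (L j)) ∧ y i₀ < R - MvPolynomial.eval x σ ∧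
          y i₀ < |MvPolynomial.eval x (logPolyDet L b p)| ∧
          (∀ i, i ≠ i₀ → logPolyMap L b p x i = y i) ∧ logPolyMap L b p x i₀ = t) :
    2 * S.card ≤ ∑ a, (T a).card := by
  classical
  let emb : Bool → Option (Option ι) → Bool ⊕ Option ι := fun e o => o.elim (Sum.inl e) Sum.inr
  let B : Bool → Finset (Fin K → ℝ) := fun e =>
    (Finset.univ.biUnion T).filter fun x => (∀ o, y i₀ ≤ MvPolynomial.eval x (q (emb e o))) ∧
      ∃ o, MvPolynomial.eval x (q (emb e o)) = y i₀
  have hqJ : ∀ e x, MvPolynomial.eval x (q (Sum.inl e)) =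
      if e then MvPolynomial.eval x (logPolyDet L b p)
      else -MvPolynomial.eval x (logPolyDet L b p) := by
    rintro (_ | _) x <;> simp [hq]
  have hqσ : ∀ x, MvPolynomial.eval x (q (Sum.inr none)) = R - MvPolynomial.eval x σ := by
    simp [hq]
  have hqL : ∀ j x, MvPolynomial.eval x (q (Sum.inr (some j))) = MvPolynomial.eval x (L j) := by
    simp [hq]
  have hface : ∀ e x, (∀ o, y i₀ ≤ MvPolynomial.eval x (q (emb e o))) →
      (∀ j, 0 < MvPolynomial.eval x (L j)) ∧ (logPolyJacobian L b p x).det ≠ 0 := by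
    intro e x hx
    have h1 : ∀ j, 0 < MvPolynomial.eval x (L j) := fun j => by
      have := hx (some (some j))
      simp only [emb, Option.elim_some, hqL] at this
      linarith
    refine ⟨h1, fun h0 => ?_⟩
    have h2 := hx none
    simp only [emb, Option.elim_none, hqJ, eval_logPolyDet L b p x fun j => (h1 j).ne', h0] at h2
    simp at h2
    linarith
  have hone : ∀ e, 2 * (S.filter fun x => y i₀ < MvPolynomial.eval x (q (Sum.inl e))).card
      ≤ (B e).card := by
    intro e
    refine two_mul_card_fiber_le (Φ := logPolyMap L b p) (i₀ := i₀)
      (φ := fun o x => MvPolynomial.eval x (q (emb e o))) (s := y i₀) (t := t) (c := y)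
      (fun o => MvPolynomial.continuous_eval _) ?_
      (fun x hx => map_nhds_logPolyMap L b p x (hface e x hx).1 (hface e x hx).2)
      (fun x hx => exists_injOn_logPolyMap L b p x (hface e x hx).1 (hface e x hx).2)
      (B e) ?_ ?_ _ ?_
    · refine (hcomp (y i₀) hy R).of_isClosed_subset ?_ ?_
      · have : {x | ∀ o, y i₀ ≤ MvPolynomial.eval x (q (emb e o))} =
            ⋂ o, {x | y i₀ ≤ MvPolynomial.eval x (q (emb e o))} := by ext; simp
        rw [this]
        exact isClosed_iInter fun o => isClosed_le continuous_const
          (MvPolynomial.continuous_eval _)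
      · intro x hx
        refine ⟨fun j => ?_, ?_⟩
        · have := hx (some (some j))
          simpa only [emb, Option.elim_some, hqL] using this
        · have := hx (some none)
          simp only [emb, Option.elim_some, hqσ] at this
          linarith
    · intro x
      simp only [B, Finset.mem_filter, Finset.mem_biUnion, Finset.mem_univ, true_and]
      constructor
      · rintro ⟨⟨a, ha⟩, h1, h2⟩
        exact ⟨h1, h2, ((hT a x).1 ha).2.1⟩
      · rintro ⟨h1, ⟨o, h2⟩, h3⟩
        exact ⟨⟨emb e o, (hT _ x).2 ⟨(hface e x h1).1, h3, h2⟩⟩, h1, o, h2⟩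
    · intro x hx
      obtain ⟨hx1, -⟩ := Finset.mem_filter.1 hx
      obtain ⟨a, -, ha⟩ := Finset.mem_biUnion.1 hx1
      exact ht a x ha
    · intro x hx
      obtain ⟨hx1, hx2⟩ := Finset.mem_filter.1 hx
      obtain ⟨h1, h2, -, h4, h5⟩ := hS x hx1
      refine ⟨?_, h4, h5⟩
      rintro (_ | _ | j)
      · exact hx2
      · simpa only [emb, Option.elim_some, hqσ] using h2
      · simpa only [emb, Option.elim_some, hqL] using h1 j
  have hdisj : Disjoint (B true) (B false) := by
    rw [Finset.disjoint_left]
    intro x h1 h2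
    have h3 := (Finset.mem_filter.1 h1).2.1 none
    have h4 := (Finset.mem_filter.1 h2).2.1 none
    simp only [emb, Option.elim_none, hqJ] at h3 h4
    simp at h3 h4
    linarith
  have hcover : S.card ≤ (S.filter fun x => y i₀ < MvPolynomial.eval x (q (Sum.inl true))).card +
      (S.filter fun x => y i₀ < MvPolynomial.eval x (q (Sum.inl false))).card := by
    refine (Finset.card_le_card fun x hx => ?_).trans (Finset.card_union_le _ _)
    have h1 := (hS x hx).2.2.1
    rcases lt_abs.1 h1 with h | h
    · exact Finset.mem_union_left _ (Finset.mem_filter.2 ⟨hx, by simpa [hqJ] using h⟩)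
    · exact Finset.mem_union_right _ (Finset.mem_filter.2 ⟨hx, by simpa [hqJ] using h⟩)
  have h1 := hone true
  have h2 := hone false
  have h3 : (B true ∪ B false).card ≤ ∑ a, (T a).card :=
    (Finset.card_le_card (Finset.union_subset (Finset.filter_subset _ _)
      (Finset.filter_subset _ _))).trans Finset.card_biUnion_le
  rw [Finset.card_union_of_disjoint hdisj] at h3
  omega

theorem card_le_prod_mul_rolleBound [DecidableEq ι] (L : ι → MvPolynomial (Fin K) ℝ)
    (hL : ∀ j, (L j).totalDegree ≤ 1) (σ : MvPolynomial (Fin K) ℝ) (hσ : σ.totalDegree ≤ 1)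
    (hcomp : ∀ δ > 0, ∀ R, IsCompact {x | (∀ j, δ ≤ MvPolynomial.eval x (L j)) ∧
      MvPolynomial.eval x σ ≤ R}) (r : ℕ) :
    ∀ (I : Finset (Fin K)) (_ : I.card = r) (b : Fin K → ι → ℝ)
      (p : Fin K → MvPolynomial (Fin K) ℝ) (d : Fin K → ℕ) (D : ℕ) (_ : 1 ≤ D)
      (_ : ∀ i ∈ I, p i = 0) (_ : ∀ i ∉ I, b i = 0) (_ : ∀ i ∉ I, (p i).totalDegree ≤ d i)
      (_ : Fintype.card ι + ∑ i ∈ Iᶜ, (d i - 1) ≤ D + I.card)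
      (c : Fin K → ℝ) (S : Finset (Fin K → ℝ))
      (_ : ∀ x ∈ S, (∀ j, 0 < MvPolynomial.eval x (L j)) ∧ logPolyMap L b p x = c ∧
        (logPolyJacobian L b p x).det ≠ 0),
      (S.card : ℝ) ≤ (∏ i ∈ Iᶜ, d i : ℕ) * rolleBound (Fintype.card ι + 1) r D := by
  induction r with
  | zero =>
    intro I hI b p d D _ _ hb hpd _ c S hS
    obtain rfl := Finset.card_eq_zero.1 hI
    have hb' : ∀ i, b i = 0 := fun i => hb i (by simp)
    simp only [Finset.compl_empty, rolleBound, mul_one]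
    norm_cast
    refine card_le_prod_of_det_ne_zero d p (fun i => hpd i (by simp)) c S (fun x hx i => ?_)
      fun x hx => ?_
    · rw [← (hS x hx).2.1]
      simp [logPolyMap, hb']
    · have := (hS x hx).2.2
      simpa [logPolyJacobian, hb'] using this
  | succ r ih =>
    intro I hI b p d D hD1 hp hb hpd hD c S hS
    obtain ⟨i₀, hi₀⟩ : I.Nonempty := Finset.card_pos.1 (by omega)
    obtain ⟨R, hR⟩ : ∃ R : ℝ, ∀ x ∈ S, MvPolynomial.eval x σ < R := by
      obtain ⟨M, hM⟩ := ((S.image fun x => MvPolynomial.eval x σ).finite_toSet).bddAbove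
      exact ⟨M + 1, fun x hx => by
        linarith [hM (Finset.mem_coe.2 (Finset.mem_image_of_mem
          (fun x => MvPolynomial.eval x σ) hx))]⟩
    set q : Bool ⊕ Option ι → MvPolynomial (Fin K) ℝ :=
      Sum.elim (fun e => if e then logPolyDet L b p else -logPolyDet L b p)
        (fun o => o.elim (MvPolynomial.C R - σ) L) with hq
    have hJd := totalDegree_logPolyDet_le L b p I d D hL hp hb hpd hD
    let dq : Bool ⊕ Option ι → ℕ := Sum.elim (fun _ => D) (fun _ => 1)
    let Dq : Bool ⊕ Option ι → ℕ := Sum.elim (fun _ => 2 * D) (fun _ => D + 1)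
    have hqd : ∀ a, (q a).totalDegree ≤ dq a := by
      rintro ((_ | _) | (_ | j))
      · simpa [hq, dq] using hJd
      · simpa [hq, dq] using hJd
      · exact (MvPolynomial.totalDegree_sub _ _).trans (by simpa [dq] using hσ)
      · exact hL j
    have hI' : i₀ ∉ Iᶜ := by simpa using hi₀
    have hsum : ∀ a, Fintype.card ι + ∑ i ∈ (I.erase i₀)ᶜ, (Function.update d i₀ (dq a) i - 1)
        ≤ Dq a + (I.erase i₀).card := by
      intro a
      rw [Finset.compl_erase, Finset.sum_insert hI', Function.update_self,
        Finset.sum_congr rfl (g := fun i => d i - 1) fun i hi => by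
          rw [Function.update_of_ne (ne_of_mem_of_not_mem hi hI')], Finset.card_erase_of_mem hi₀]
      rcases a with a | a <;> simp only [dq, Dq, Sum.elim_inl, Sum.elim_inr] <;> omega
    have hprod : ∀ a, ∏ i ∈ (I.erase i₀)ᶜ, Function.update d i₀ (dq a) i
        = dq a * ∏ i ∈ Iᶜ, d i := by
      intro a
      rw [Finset.compl_erase, Finset.prod_insert hI', Function.update_self]
      congr 1
      exact Finset.prod_congr rfl fun i hi => by
          rw [Function.update_of_ne (ne_of_mem_of_not_mem hi hI')]
    obtain ⟨y, hy, hyZ, hyt⟩ := exists_perturbed_fiber L b p σ (logPolyDet L b p) i₀ c S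
      (fun x hx => ⟨(hS x hx).1, (hS x hx).2.1, (hS x hx).2.2, by
        rw [eval_logPolyDet L b p x fun j => ((hS x hx).1 j).ne']
        exact mul_ne_zero (Finset.prod_ne_zero_iff.2 fun j _ => ((hS x hx).1 j).ne')
          (hS x hx).2.2⟩) R hR _
      (fun a => volume_critical_values_logPolyMap L (Function.update b i₀ 0)
        (Function.update p i₀ (q a)))
    have hfin : ∀ a, ∃ T : Finset (Fin K → ℝ), (T : Set (Fin K → ℝ)) =
        {x | (∀ j, 0 < MvPolynomial.eval x (L j)) ∧
          (∀ i, i ≠ i₀ → logPolyMap L b p x i = y i) ∧ MvPolynomial.eval x (q a) = y i₀} ∧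
        (T.card : ℝ) ≤ (dq a * ∏ i ∈ Iᶜ, d i : ℕ) * rolleBound (Fintype.card ι + 1) r (Dq a) := by
      intro a
      refine Set.exists_finset_eq_card_le fun S' hS' => ?_
      rw [← hprod a]
      refine ih (I.erase i₀) (by rw [Finset.card_erase_of_mem hi₀]; omega)
        (Function.update b i₀ 0) (Function.update p i₀ (q a)) (Function.update d i₀ (dq a)) (Dq a)
        ?_ ?_ ?_ ?_ (hsum a) y S' ?_
      · rcases a with a | a <;> simp only [Dq, Sum.elim_inl, Sum.elim_inr] <;> omega
      · intro i hi
        rw [Function.update_of_ne (Finset.ne_of_mem_erase hi), hp i (Finset.mem_of_mem_erase hi)]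
      · intro i hi
        by_cases h : i = i₀
        · rw [h, Function.update_self]
        · rw [Function.update_of_ne h, hb i fun h' => hi (Finset.mem_erase.2 ⟨h, h'⟩)]
      · intro i hi
        by_cases h : i = i₀
        · rw [h, Function.update_self, Function.update_self]
          exact hqd a
        · rw [Function.update_of_ne h, Function.update_of_ne h]
          exact hpd i fun h' => hi (Finset.mem_erase.2 ⟨h, h'⟩)
      · intro x hx
        obtain ⟨h1, h2⟩ := hS' hx
        have h3 := (logPolyMap_update_eq_iff L b p i₀ (q a) x y).2 h2
        exact ⟨h1, h3, fun h4 => hyZ a ⟨x, ⟨h1, h4⟩, h3⟩⟩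
    choose T hT hTc using hfin
    obtain ⟨t, ht, S', hS'c, hS'⟩ := hyt
      (⋃ a, (fun x => logPolyMap L b p x i₀) '' (T a : Set (Fin K → ℝ)))
      (Set.finite_iUnion fun a => (T a).finite_toSet.image _)
    have hmain := two_mul_card_le_of_face_sets L b p σ i₀ hcomp R t y hy q hq T
      (fun a x => by rw [← Finset.mem_coe, hT]; rfl)
      (fun a x hx h => ht (Set.mem_iUnion.2 ⟨a, x, hx, h⟩)) S' hS'
    rw [hS'c] at hmain
    have hsumT : ((∑ a, (T a).card : ℕ) : ℝ) ≤ ∑ a, (dq a * ∏ i ∈ Iᶜ, d i : ℕ) *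
        rolleBound (Fintype.card ι + 1) r (Dq a) := by
      push_cast
      exact Finset.sum_le_sum fun a _ => by simpa using hTc a
    have hmain' : (2 : ℝ) * S.card ≤ ((∑ a, (T a).card : ℕ) : ℝ) := by exact_mod_cast hmain
    have h := hmain'.trans hsumT
    rw [Fintype.sum_sum_type] at h
    simp only [dq, Dq, Sum.elim_inl, Sum.elim_inr, Finset.sum_const, Finset.card_univ,
      Fintype.card_bool, Fintype.card_option, nsmul_eq_mul] at h
    rw [rolleBound]
    push_cast at h ⊢
    linarith

end LogPoly

theorem rolleBound_succ_le (F r D : ℕ) (hD : 2 ≤ D) :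
    rolleBound F (r + 1) D ≤ 2 ^ (r * (r + 1) / 2) * (D + F / 2 * (3 / 4 : ℝ) ^ r) ^ (r + 1) := by
  induction r generalizing D with
  | zero => simp [rolleBound]
  | succ r ih =>
    have hD' : (2 : ℝ) ≤ D := by exact_mod_cast hD
    have h1 := ih (2 * D) (by omega)
    have h2 := ih (D + 1) (by omega)
    have hexp : (r + 1) * (r + 1 + 1) / 2 = r * (r + 1) / 2 + (r + 1) := by
      have : (r + 1) * (r + 1 + 1) = r * (r + 1) + (r + 1) * 2 := by ring
      rw [this, Nat.add_mul_div_right _ _ (by norm_num)]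
    set G : ℝ := D + F / 2 * (3 / 4 : ℝ) ^ (r + 1) with hG
    have hP : (0 : ℝ) ≤ F / 2 * (3 / 4 : ℝ) ^ r := by positivity
    have h3 : (((2 * D : ℕ) : ℝ) + F / 2 * (3 / 4 : ℝ) ^ r) ^ (r + 1) ≤ (2 * G) ^ (r + 1) := by
      gcongr
      rw [hG, pow_succ]
      push_cast
      linarith
    have h4 : (((D + 1 : ℕ) : ℝ) + F / 2 * (3 / 4 : ℝ) ^ r) ^ (r + 1)
        ≤ (3 / 4 * (2 * G)) ^ (r + 1) := by
      gcongr
      rw [hG, pow_succ]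
      push_cast
      linarith
    rw [rolleBound, hexp]
    calc (D : ℝ) * rolleBound F (r + 1) (2 * D) + F / 2 * rolleBound F (r + 1) (D + 1)
        ≤ D * (2 ^ (r * (r + 1) / 2) * (2 * G) ^ (r + 1))
          + F / 2 * (2 ^ (r * (r + 1) / 2) * (3 / 4 * (2 * G)) ^ (r + 1)) := by
          gcongr
          · exact h1.trans (by gcongr)
          · exact h2.trans (by gcongr)
      _ = 2 ^ (r * (r + 1) / 2 + (r + 1)) * G ^ (r + 1 + 1) := by
          rw [pow_succ G (r + 1)]
          nth_rewrite 4 [hG]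
          rw [mul_pow (3 / 4) (2 * G), mul_pow, pow_add]
          ring

theorem succ_mul_add_six_mul_pow_le (r : ℕ) :
    ((r : ℝ) + 1) * (r + 6) * (3 / 4 : ℝ) ^ r ≤ 16 := by
  rcases lt_or_ge r 4 with h | h
  · interval_cases r <;> norm_num
  · induction r, h using Nat.le_induction with
    | base => norm_num
    | succ m hm ih =>
      have hm' : (4 : ℝ) ≤ m := by exact_mod_cast hm
      refine le_trans ?_ ih
      rw [pow_succ]
      push_cast
      have hP : (0 : ℝ) ≤ (3 / 4 : ℝ) ^ m := by positivity
      nlinarith [mul_nonneg hP (show (0 : ℝ) ≤ (m + 1) * (m + 6) - (m + 2) * (m + 7) * (3 / 4) by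
        nlinarith)]

theorem one_add_rolleBound_lt (n k : ℕ) (hn : 2 ≤ n) :
    1 + rolleBound (n + k + 3) k (n + 2) <
      (Real.exp 1 ^ 2 + 3) / 4 * 2 ^ (k * (k + 1) / 2) * 2 ^ n * (n : ℝ) ^ (k + 1) := by
  have hn' : (2 : ℝ) ≤ n := by exact_mod_cast hn
  have he1 : (2.7 : ℝ) < Real.exp 1 := by linarith [Real.exp_one_gt_d9]
  have he2 : Real.exp 1 < 2.8 := by linarith [Real.exp_one_lt_d9]
  have hC : (2 : ℝ) ≤ (Real.exp 1 ^ 2 + 3) / 4 := by nlinarith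
  have h2n : (4 : ℝ) ≤ 2 ^ n := by
    calc (4 : ℝ) = 2 ^ 2 := by norm_num
      _ ≤ 2 ^ n := pow_le_pow_right₀ (by norm_num) hn
  have h2n' : (8 : ℝ) ≤ 2 ^ n * n := by nlinarith
  have hCn : (16 : ℝ) ≤ (Real.exp 1 ^ 2 + 3) / 4 * (2 ^ n * n) := by nlinarith
  rcases k with _ | r
  · simp only [rolleBound, Nat.zero_div, pow_zero, zero_add, pow_one, mul_one]
    linarith
  · have h1 := rolleBound_succ_le (n + (r + 1) + 3) r (n + 2) (by omega)
    have hexp : (r + 1) * (r + 1 + 1) / 2 = r * (r + 1) / 2 + (r + 1) := by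
      have : (r + 1) * (r + 1 + 1) = r * (r + 1) + (r + 1) * 2 := by ring
      rw [this, Nat.add_mul_div_right _ _ (by norm_num)]
    set x : ℝ := (r + 6) / 8 * (3 / 4 : ℝ) ^ r with hx
    have hx0 : 0 ≤ x := by positivity
    have h2 : ((n + 2 : ℕ) : ℝ) + ((n + (r + 1) + 3 : ℕ) : ℝ) / 2 * (3 / 4 : ℝ) ^ r
        ≤ 2 * n * Real.exp x := by
      have h3 : ((n + (r + 1) + 3 : ℕ) : ℝ) / 2 ≤ (n + 2) * ((r + 6) / 8) := by
        push_cast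
        nlinarith [mul_nonneg (Nat.cast_nonneg (α := ℝ) r) (sub_nonneg.2 hn')]
      calc ((n + 2 : ℕ) : ℝ) + ((n + (r + 1) + 3 : ℕ) : ℝ) / 2 * (3 / 4 : ℝ) ^ r
          ≤ (n + 2) + (n + 2) * ((r + 6) / 8) * (3 / 4 : ℝ) ^ r := by
            push_cast at h3 ⊢; gcongr
        _ = (n + 2) * (x + 1) := by rw [hx]; ring
        _ ≤ 2 * n * Real.exp x := by
            gcongr
            · linarith
            · exact Real.add_one_le_exp x
    have h3 : Real.exp x ^ (r + 1) ≤ 8 := by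
      rw [← Real.exp_nat_mul]
      have h4 : ((r + 1 : ℕ) : ℝ) * x ≤ 1 + 1 := by
        have := succ_mul_add_six_mul_pow_le r
        rw [hx]
        push_cast
        linarith
      calc Real.exp (((r + 1 : ℕ) : ℝ) * x) ≤ Real.exp (1 + 1) := Real.exp_le_exp.2 h4
        _ = Real.exp 1 * Real.exp 1 := Real.exp_add _ _
        _ ≤ 8 := by nlinarith [Real.exp_pos 1]
    set Q : ℝ := 2 ^ (r * (r + 1) / 2) * (2 * n) ^ (r + 1) with hQ
    have hQ1 : 1 ≤ Q := by
      refine one_le_mul_of_one_le_of_one_le (one_le_pow₀ (by norm_num)) (one_le_pow₀ (by linarith))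
    have h4 : rolleBound (n + (r + 1) + 3) (r + 1) (n + 2) ≤ Q * 8 := by
      refine h1.trans ?_
      calc _ ≤ 2 ^ (r * (r + 1) / 2) * (2 * n * Real.exp x) ^ (r + 1) := by gcongr
        _ = Q * Real.exp x ^ (r + 1) := by rw [mul_pow, hQ]; ring
        _ ≤ Q * 8 := by gcongr
    calc 1 + rolleBound (n + (r + 1) + 3) (r + 1) (n + 2) < Q * 16 := by linarith
      _ ≤ Q * ((Real.exp 1 ^ 2 + 3) / 4 * (2 ^ n * n)) := by gcongr
      _ = _ := by
        rw [hexp, hQ, mul_pow]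
        ring

theorem exists_pairwiseDisjoint_isOpen_of_connectedComponentIn {E : Type*} [TopologicalSpace E]
    [T2Space E] [LocallyCompactSpace E] {A : Set E} (hA : IsCompact A) (S : Finset E)
    (hSA : ∀ x ∈ S, x ∈ A)
    (hd : ∀ x ∈ S, ∀ y ∈ S, y ∈ connectedComponentIn A x → x = y) :
    ∃ U : E → Set E, (∀ x ∈ S, x ∈ U x ∧ IsOpen (U x) ∧ IsCompact (closure (U x)) ∧
      closure (U x) ∩ A ⊆ U x) ∧ (S : Set E).PairwiseDisjoint U := by
  classical
  have _ : CompactSpace A := isCompact_iff_compactSpace.1 hA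
  have h1 : ∀ x ∈ S, ∀ y ∈ S, x ≠ y → ∃ Z : Set A, IsClopen Z ∧ (∃ h : x ∈ A, ⟨x, h⟩ ∈ Z) ∧
      ∀ h : y ∈ A, ⟨y, h⟩ ∉ Z := by
    intro x hx y hy hxy
    have h2 : (⟨y, hSA y hy⟩ : A) ∉ connectedComponent (⟨x, hSA x hx⟩ : A) := fun h =>
      hxy (hd x hx y hy (by
        rw [connectedComponentIn_eq_image (hSA x hx)]
        exact ⟨_, h, rfl⟩))
    rw [connectedComponent_eq_iInter_isClopen, Set.mem_iInter] at h2
    push Not at h2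
    obtain ⟨Z, hZ⟩ := h2
    exact ⟨Z, Z.2.1, ⟨hSA x hx, Z.2.2⟩, fun _ => hZ⟩
  choose! Z hZc hZx hZy using h1
  let P : E → Set A := fun x => ⋂ y ∈ S.erase x, Z x y
  let Q : E → Set A := fun x => P x \ ⋃ y ∈ S.erase x, P y
  have hP : ∀ x ∈ S, IsClopen (P x) := fun x hx =>
    Set.Finite.isClopen_biInter (Finset.finite_toSet _) fun y hy =>
      hZc x hx y (Finset.mem_of_mem_erase hy) (Finset.ne_of_mem_erase hy).symm
  have hQ : ∀ x ∈ S, IsClopen (Q x) := fun x hx =>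
    (hP x hx).diff (Set.Finite.isClopen_biUnion (Finset.finite_toSet _) fun y hy =>
      hP y (Finset.mem_of_mem_erase hy))
  have hxQ : ∀ x (hx : x ∈ S), (⟨x, hSA x hx⟩ : A) ∈ Q x := by
    intro x hx
    refine ⟨Set.mem_iInter₂.2 fun y hy => ?_, fun h => ?_⟩
    · exact (hZx x hx y (Finset.mem_of_mem_erase hy) (Finset.ne_of_mem_erase hy).symm).2
    · obtain ⟨y, hy, hxy⟩ := Set.mem_iUnion₂.1 h
      obtain ⟨hyx, hyS⟩ := Finset.mem_erase.1 hy
      exact hZy y hyS x hx hyx _ (Set.mem_iInter₂.1 hxy x (Finset.mem_erase.2 ⟨hyx.symm, hx⟩))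
  have hQd : ∀ x ∈ S, ∀ y ∈ S, x ≠ y → Disjoint (Q x) (Q y) := by
    intro x hx y hy hxy
    rw [Set.disjoint_left]
    intro a ha hb
    exact hb.2 (Set.mem_iUnion₂.2 ⟨x, Finset.mem_erase.2 ⟨hxy, hx⟩, ha.1⟩)
  have hval : IsClosedMap (Subtype.val : A → E) := hA.isClosed.isClosedMap_subtype_val
  have hL : ∀ x ∈ S, ∃ L, IsCompact L ∧ Subtype.val '' (Q x) ⊆ interior L ∧
      L ⊆ (Subtype.val '' (Q x)ᶜ)ᶜ := fun x hx =>
    exists_compact_between ((hQ x hx).isClosed.isCompact.image continuous_subtype_val)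
      (hval _ (hQ x hx).compl.isClosed).isOpen_compl (by
        rintro _ ⟨a, ha, rfl⟩ ⟨b, hb, hab⟩
        exact hb (Subtype.ext hab ▸ ha))
  choose! L hLc hLi hLs using hL
  have hLcl : ∀ x, x ∈ S → IsClosed (⋃ y ∈ S.erase x, L y) := fun x hx =>
    Set.Finite.isClosed_biUnion (Finset.finite_toSet _) fun y hy =>
      (hLc y (Finset.mem_of_mem_erase hy)).isClosed
  let U : E → Set E := fun x => interior (L x) \ ⋃ y ∈ S.erase x, L y
  have hQU : ∀ x ∈ S, Subtype.val '' (Q x) ⊆ U x := by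
    intro x hx a ha
    refine ⟨hLi x hx ha, fun h => ?_⟩
    obtain ⟨y, hy, hay⟩ := Set.mem_iUnion₂.1 h
    obtain ⟨hyx, hyS⟩ := Finset.mem_erase.1 hy
    obtain ⟨a', ha', rfl⟩ := ha
    exact hLs y hyS hay ⟨a', fun h' => Set.disjoint_left.1 (hQd y hyS x hx hyx) h' ha', rfl⟩
  have hUL : ∀ x ∈ S, closure (U x) ⊆ L x := fun x hx =>
    closure_minimal (Set.sdiff_subset.trans interior_subset) (hLc x hx).isClosed
  refine ⟨U, fun x hx => ⟨hQU x hx ⟨_, hxQ x hx, rfl⟩, ?_, ?_, ?_⟩, ?_⟩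
  · exact isOpen_interior.sdiff (hLcl x hx)
  · exact (hLc x hx).of_isClosed_subset isClosed_closure (hUL x hx)
  · rintro a ⟨ha, haA⟩
    refine hQU x hx ⟨⟨a, haA⟩, ?_, rfl⟩
    by_contra hno
    exact hLs x hx (hUL x hx ha) ⟨⟨a, haA⟩, hno, rfl⟩
  · intro x hx y hy hxy
    change Disjoint (U x) (U y)
    rw [Set.disjoint_left]
    intro a ha hb
    exact hb.2 (Set.mem_iUnion₂.2 ⟨x, Finset.mem_erase.2 ⟨hxy, hx⟩, interior_subset ha.1⟩)

section Critical

variable {E G : Type*} [NormedAddCommGroup E] [NormedSpace ℝ E] [FiniteDimensional ℝ E]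
  [NormedAddCommGroup G] [NormedSpace ℝ G] [FiniteDimensional ℝ G]

theorem eventually_exists_critical_point {F T : E × G → ℝ} (hF : ContDiff ℝ 1 F)
    (hT : ContDiff ℝ 1 T) (γ : G) (hreg : ∀ z, F (z, γ) = 0 → ∃ h, fderiv ℝ F (z, γ) (h, 0) ≠ 0)
    {t : ℝ} {U : Set E} (hU : IsOpen U) (hUc : IsCompact (closure U))
    (hUF : closure U ∩ {z | F (z, γ) = 0 ∧ T (z, γ) ≤ t} ⊆ U) (p : E) (hp : p ∈ U)
    (hpF : F (p, γ) = 0) (hpT : T (p, γ) < t) :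
    ∀ᶠ γ' in 𝓝 γ, ∃ y ∈ U, F (y, γ') = 0 ∧
      ∃ μ : ℝ, ∀ h, fderiv ℝ T (y, γ') (h, 0) = μ * fderiv ℝ F (y, γ') (h, 0) := by
  have _ : CompleteSpace E := FiniteDimensional.complete ℝ E
  have _ : CompleteSpace G := FiniteDimensional.complete ℝ G
  have hF' : Continuous fun z => fderiv ℝ F z := hF.continuous_fderiv one_ne_zero
  have h1 : ∀ᶠ γ' in 𝓝 γ, ∃ y ∈ U, F (y, γ') = 0 ∧ T (y, γ') < t := by
    have hs : HasStrictFDerivAt (fun z : E × G => (F z, z.2))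
        ((fderiv ℝ F (p, γ)).prod (ContinuousLinearMap.snd ℝ E G)) (p, γ) :=
      (hF.contDiffAt.hasStrictFDerivAt one_ne_zero).prodMk hasStrictFDerivAt_snd
    have hmap := hs.map_nhds_eq_of_surj (by
      rw [LinearMap.range_eq_top]
      rintro ⟨a, g⟩
      obtain ⟨h, hh⟩ := hreg p hpF
      refine ⟨(((a - fderiv ℝ F (p, γ) (0, g)) / fderiv ℝ F (p, γ) (h, 0)) • h, g), ?_⟩
      have h2 : ∀ r : ℝ, fderiv ℝ F (p, γ) (r • h, g) =
          r * fderiv ℝ F (p, γ) (h, 0) + fderiv ℝ F (p, γ) (0, g) := by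
        intro r
        rw [← smul_eq_mul, ← map_smul, ← map_add]
        simp
      simp only [ContinuousLinearMap.coe_coe, ContinuousLinearMap.prod_apply,
        ContinuousLinearMap.coe_snd', h2]
      rw [div_mul_cancel₀ _ hh]
      simp)
    rw [hpF] at hmap
    have hN : {z : E × G | z.1 ∈ U ∧ T z < t} ∈ 𝓝 (p, γ) :=
      ((hU.preimage continuous_fst).inter
        (isOpen_lt hT.continuous continuous_const)).mem_nhds ⟨hp, hpT⟩
    have h3 := image_mem_map (m := fun z : E × G => (F z, z.2)) hN
    rw [hmap] at h3
    have h4 : Tendsto (fun γ' : G => ((0 : ℝ), γ')) (𝓝 γ) (𝓝 (0, γ)) :=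
      tendsto_const_nhds.prodMk_nhds tendsto_id
    filter_upwards [h4 h3] with γ' hγ'
    obtain ⟨⟨y, g⟩, hy, hy2⟩ := hγ'
    obtain ⟨hy3, rfl⟩ := Prod.mk.inj hy2
    exact ⟨y, hy.1, hy3, hy.2⟩
  have h2 : ∀ᶠ γ' in 𝓝 γ, ∀ z ∈ closure U,
      F (z, γ') ≠ 0 ∨ ((z ∈ U ∨ t < T (z, γ')) ∧
        (fderiv ℝ F (z, γ')).comp (ContinuousLinearMap.inl ℝ E G) ≠ 0) := by
    refine hUc.eventually_forall_of_forall_eventually fun z hz => ?_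
    have hsw : Continuous fun w : G × E => (w.2, w.1) := continuous_swap
    by_cases h0 : F (z, γ) = 0
    · have h3 : z ∈ U ∨ t < T (z, γ) := by
        by_contra! h
        exact h.1 (hUF ⟨hz, h0, h.2⟩)
      have h4 : ∀ᶠ w : G × E in 𝓝 (γ, z), w.2 ∈ U ∨ t < T (w.2, w.1) :=
        ((hU.preimage continuous_snd).union
          (isOpen_lt continuous_const (hT.continuous.comp hsw))).mem_nhds h3
      have h5 : ∀ᶠ w : G × E in 𝓝 (γ, z), (fderiv ℝ F (w.2, w.1)).comp
          (ContinuousLinearMap.inl ℝ E G) ≠ 0 := by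
        refine (isOpen_ne_fun ((hF'.comp hsw).clm_comp continuous_const)
          continuous_const).mem_nhds ?_
        intro h
        obtain ⟨v, hv⟩ := hreg z h0
        exact hv (by simpa using DFunLike.congr_fun h v)
      filter_upwards [h4, h5] with w hw hw'
      exact Or.inr ⟨hw, hw'⟩
    · have h3 : ∀ᶠ w : G × E in 𝓝 (γ, z), F (w.2, w.1) ≠ 0 :=
        (isOpen_ne_fun (hF.continuous.comp hsw) continuous_const).mem_nhds h0
      filter_upwards [h3] with w hw
      exact Or.inl hw
  filter_upwards [h1, h2] with γ' ⟨y₀, hy₀U, hy₀F, hy₀T⟩ hγ'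
  have hemb : Continuous fun z : E => (z, γ') := continuous_id.prodMk continuous_const
  have hTc : Continuous fun z => T (z, γ') := hT.continuous.comp hemb
  have hKc : IsCompact (closure U ∩ {z | F (z, γ') = 0 ∧ T (z, γ') ≤ t}) :=
    hUc.inter_right ((isClosed_eq (hF.continuous.comp hemb) continuous_const).inter
      (isClosed_le hTc continuous_const))
  obtain ⟨y, ⟨hyU, hyF, hyT⟩, hymin⟩ := hKc.exists_isMinOn
    ⟨y₀, subset_closure hy₀U, hy₀F, hy₀T.le⟩ hTc.continuousOn
  obtain ⟨hyU', hyF'⟩ := (hγ' y hyU).resolve_left (not_not.2 hyF)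
  replace hyU' : y ∈ U := hyU'.resolve_right (not_lt.2 hyT)
  have hmin : IsLocalExtrOn (fun z => T (z, γ')) {z | F (z, γ') = F (y, γ')} y := by
    refine Or.inl ?_
    filter_upwards [eventually_nhdsWithin_of_eventually_nhds (hU.mem_nhds hyU'),
      self_mem_nhdsWithin] with z hz hz2
    replace hz2 : F (z, γ') = 0 := hyF ▸ hz2
    by_cases h : T (z, γ') ≤ t
    · exact hymin ⟨subset_closure hz, hz2, h⟩
    · exact hyT.trans (not_le.1 h).le
  have hcomp : ∀ {H : E × G → ℝ}, ContDiff ℝ 1 H → HasStrictFDerivAt (fun z => H (z, γ'))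
      ((fderiv ℝ H (y, γ')).comp (ContinuousLinearMap.inl ℝ E G)) y := by
    intro H hH
    exact HasStrictFDerivAt.comp (g := H) y (hH.contDiffAt.hasStrictFDerivAt one_ne_zero)
      (((hasStrictFDerivAt_id y).prodMk (hasStrictFDerivAt_const γ' y)).congr_fderiv rfl)
  obtain ⟨a, b, hab, hsum⟩ := hmin.exists_multipliers_of_hasStrictFDerivAt_1d (hcomp hF) (hcomp hT)
  refine ⟨y, hyU', hyF, -a / b, fun h => ?_⟩
  have hb : b ≠ 0 := by
    rintro rfl
    rw [zero_smul, add_zero] at hsum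
    rcases smul_eq_zero.1 hsum with h | h
    · exact hab (by rw [h]; rfl)
    · exact hyF' h
  have h3 := DFunLike.congr_fun hsum h
  simp at h3
  field_simp
  linarith

theorem eventually_exists_card_critical_points {F T : E × G → ℝ} (hF : ContDiff ℝ 1 F)
    (hT : ContDiff ℝ 1 T) (γ : G) (hreg : ∀ z, F (z, γ) = 0 → ∃ h, fderiv ℝ F (z, γ) (h, 0) ≠ 0)
    (hcomp : ∀ t, IsCompact {z | T (z, γ) ≤ t}) (S : Finset E) (hS : ∀ z ∈ S, F (z, γ) = 0)
    (hd : ∀ x ∈ S, ∀ y ∈ S, y ∈ connectedComponentIn {z | F (z, γ) = 0} x → x = y) :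
    ∀ᶠ γ' in 𝓝 γ, ∃ S' : Finset E, S'.card = S.card ∧ ∀ y ∈ S', F (y, γ') = 0 ∧
      ∃ μ : ℝ, ∀ h, fderiv ℝ T (y, γ') (h, 0) = μ * fderiv ℝ F (y, γ') (h, 0) := by
  classical
  have _ : ProperSpace E := FiniteDimensional.proper ℝ E
  obtain ⟨t, ht⟩ : ∃ t, ∀ z ∈ S, T (z, γ) < t := by
    obtain ⟨M, hM⟩ := ((S.image fun z => T (z, γ)).finite_toSet).bddAbove
    exact ⟨M + 1, fun z hz => by
      linarith [hM (Finset.mem_coe.2 (Finset.mem_image_of_mem (fun z => T (z, γ)) hz))]⟩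
  have hemb : Continuous fun z : E => (z, γ) := continuous_id.prodMk continuous_const
  have hA : IsCompact {z | F (z, γ) = 0 ∧ T (z, γ) ≤ t} :=
    (hcomp t).inter_left (isClosed_eq (hF.continuous.comp hemb) continuous_const)
  obtain ⟨U, hU, hUd⟩ := exists_pairwiseDisjoint_isOpen_of_connectedComponentIn hA S
    (fun z hz => ⟨hS z hz, (ht z hz).le⟩) fun x hx y hy hxy =>
      hd x hx y hy (connectedComponentIn_mono x (fun z hz => hz.1) hxy)
  have hev : ∀ᶠ γ' in 𝓝 γ, ∀ z ∈ S, ∃ y ∈ U z, F (y, γ') = 0 ∧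
      ∃ μ : ℝ, ∀ h, fderiv ℝ T (y, γ') (h, 0) = μ * fderiv ℝ F (y, γ') (h, 0) :=
    (Finset.eventually_all S).2 fun z hz =>
      eventually_exists_critical_point hF hT γ hreg (hU z hz).2.1 (hU z hz).2.2.1 (hU z hz).2.2.2
        z (hU z hz).1 (hS z hz) (ht z hz)
  filter_upwards [hev] with γ' hγ'
  choose! w hwU hw using hγ'
  refine ⟨S.image w, Finset.card_image_of_injOn fun a ha b hb hab => ?_, fun y hy => ?_⟩
  · by_contra hne
    exact Set.disjoint_left.1 (hUd ha hb hne) (hwU a ha) (hab ▸ hwU b hb)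
  · obtain ⟨a, ha, rfl⟩ := Finset.mem_image.1 hy
    exact hw a ha

end Critical

theorem exists_injective_range_eq_dotProduct_orthogonal {τ : Type*} [Fintype τ]
    (U : Submodule ℝ (τ → ℝ)) (k : ℕ) (hk : Module.finrank ℝ U + k = Fintype.card τ) :
    ∃ e : (Fin k → ℝ) →ₗ[ℝ] (τ → ℝ), Function.Injective e ∧
      ∀ v, (∃ u, e u = v) ↔ ∀ h ∈ U, v ⬝ᵥ h = 0 := by
  classical
  set V : Submodule ℝ (τ → ℝ) :=
    U.dualAnnihilator.comap (dotProductEquiv ℝ τ).toLinearMap with hV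
  have h1 : Module.finrank ℝ V = k := by
    have h2 := Subspace.finrank_add_finrank_dualAnnihilator_eq U
    have h3 : Module.finrank ℝ V = Module.finrank ℝ U.dualAnnihilator := by
      rw [hV, Submodule.comap_equiv_eq_map_symm, LinearEquiv.finrank_map_eq]
    rw [Module.finrank_pi] at h2
    omega
  let e₀ : (Fin k → ℝ) ≃ₗ[ℝ] V := LinearEquiv.ofFinrankEq _ _ (by simp [h1])
  refine ⟨V.subtype ∘ₗ e₀.toLinearMap,
    Subtype.val_injective.comp e₀.injective, fun v => ?_⟩
  have h4 : v ∈ V ↔ ∀ h ∈ U, v ⬝ᵥ h = 0 := by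
    rw [hV, Submodule.mem_comap, Submodule.mem_dualAnnihilator]
    rfl
  rw [← h4]
  constructor
  · rintro ⟨u, rfl⟩
    exact (e₀ u).2
  · intro h
    exact ⟨e₀.symm ⟨v, h⟩, by simp⟩

theorem exists_injective_range_eq_dotProduct_orthogonal_and {τ : Type*} [Fintype τ]
    (W : Submodule ℝ (τ → ℝ)) (n k : ℕ) (hn : Module.finrank ℝ W = n)
    (hk : Fintype.card τ = n + k + 1) (β p : τ → ℝ) (hβ : ∀ h ∈ W, β ⬝ᵥ h = 0)
    (hp : β ⬝ᵥ p ≠ 0) :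
    ∃ e : (Fin k → ℝ) →ₗ[ℝ] (τ → ℝ), Function.Injective e ∧
      ∀ v, (∃ u, e u = v) ↔ (∀ h ∈ W, v ⬝ᵥ h = 0) ∧ v ⬝ᵥ p = 0 := by
  have hpW : p ∉ W := fun h => hp (hβ p h)
  have hd : Disjoint W (Submodule.span ℝ {p}) := by
    rw [Submodule.disjoint_span_singleton]
    exact fun h => absurd h hpW
  have hp0 : p ≠ 0 := fun h => hpW (h ▸ W.zero_mem)
  have h1 := Submodule.finrank_sup_add_finrank_inf_eq W (Submodule.span ℝ {p})
  rw [hd.eq_bot, finrank_bot, finrank_span_singleton hp0, hn] at h1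
  obtain ⟨e, he, he'⟩ := exists_injective_range_eq_dotProduct_orthogonal
    (W ⊔ Submodule.span ℝ {p}) k (by omega)
  refine ⟨e, he, fun v => (he' v).trans ?_⟩
  constructor
  · intro h
    exact ⟨fun w hw => h w (Submodule.mem_sup_left hw),
      h p (Submodule.mem_sup_right (Submodule.mem_span_singleton_self p))⟩
  · rintro ⟨h2, h3⟩ x hx
    obtain ⟨y, hy, z, hz, rfl⟩ := Submodule.mem_sup.1 hx
    obtain ⟨a, rfl⟩ := Submodule.mem_span_singleton.1 hz
    rw [dotProduct_add, h2 y hy, dotProduct_smul, h3, smul_zero, add_zero]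

section ExponentialSum

variable {τ : Type*} [Fintype τ]

theorem eq_of_critical_of_abs_le_one [Nonempty τ] (W : Submodule ℝ (τ → ℝ)) (s : τ → ℝ)
    (hs : ∀ j, s j = 1 ∨ s j = -1)
    (hgen : ∀ e : ℝ, (∃ w ∈ W, ∃ t : ℝ, t ≠ 0 ∧ ∀ j, s j = e → w j = t) ∨
      ∀ w ∈ W, (∀ j, s j = e → w j = 0) → w = 0)
    (γ : τ → ℝ) {y y' : τ → ℝ} (hy : y ∈ W) (hy' : y' ∈ W)
    (hF : ∑ j, s j * Real.exp (y j + γ j) = 0) (hF' : ∑ j, s j * Real.exp (y' j + γ j) = 0)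
    {μ μ' : ℝ} (hμ : |μ| ≤ 1) (hμ' : |μ'| ≤ 1)
    (hc : ∀ h ∈ W, ∑ j, Real.exp (y j + γ j) * h j = μ * ∑ j, s j * Real.exp (y j + γ j) * h j)
    (hc' : ∀ h ∈ W,
      ∑ j, Real.exp (y' j + γ j) * h j = μ' * ∑ j, s j * Real.exp (y' j + γ j) * h j) :
    y = y' := by
  have key : ∀ {z z' : τ → ℝ} {ν : ℝ}, z ∈ W → z' ∈ W → ∑ j, s j * Real.exp (z j + γ j) = 0 →
      ∑ j, s j * Real.exp (z' j + γ j) = 0 →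
      (∀ h ∈ W, ∑ j, Real.exp (z j + γ j) * h j = ν * ∑ j, s j * Real.exp (z j + γ j) * h j) →
      ∑ j, (1 - ν * s j) * (Real.exp (z j + γ j) * (Real.exp (z' j - z j) - 1 - (z' j - z j)))
        = ∑ j, Real.exp (z' j + γ j) - ∑ j, Real.exp (z j + γ j) := by
    intro z z' ν hz hz' h0 h0' hcr
    have h1 := hcr _ (W.sub_mem hz' hz)
    have h2 : ∀ j, (1 - ν * s j) * (Real.exp (z j + γ j) * (Real.exp (z' j - z j) - 1 - (z' j - z j)))
        = Real.exp (z' j + γ j) - ν * (s j * Real.exp (z' j + γ j)) - Real.exp (z j + γ j)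
          + ν * (s j * Real.exp (z j + γ j)) - Real.exp (z j + γ j) * (z' - z) j
          + ν * (s j * Real.exp (z j + γ j) * (z' - z) j) := by
      intro j
      have h3 : Real.exp (z' j + γ j) = Real.exp (z j + γ j) * Real.exp (z' j - z j) := by
        rw [← Real.exp_add]
        congr 1
        ring
      rw [h3, Pi.sub_apply]
      ring
    rw [Finset.sum_congr rfl fun j _ => h2 j]
    simp only [Finset.sum_add_distrib, Finset.sum_sub_distrib, ← Finset.mul_sum, h0, h0', h1]
    ring
  have hconv : ∀ x : ℝ, 0 ≤ Real.exp x - 1 - x := fun x => by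
    linarith [Real.add_one_le_exp x]
  have hco : ∀ {ν : ℝ}, |ν| ≤ 1 → ∀ j, 0 ≤ 1 - ν * s j := by
    intro ν hν j
    rw [abs_le] at hν
    rcases hs j with h | h <;> rw [h] <;> linarith
  have hnn : ∀ {z z' : τ → ℝ} {ν : ℝ}, |ν| ≤ 1 → ∀ j ∈ Finset.univ,
      0 ≤ (1 - ν * s j) * (Real.exp (z j + γ j) * (Real.exp (z' j - z j) - 1 - (z' j - z j))) :=
    fun hν j _ => mul_nonneg (hco hν j) (mul_nonneg (Real.exp_pos _).le (hconv _))
  have h1 := key hy hy' hF hF' hc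
  have h2 := key hy' hy hF' hF hc'
  have h3 := Finset.sum_nonneg (hnn (z := y) (z' := y') hμ)
  have h4 := Finset.sum_nonneg (hnn (z := y') (z' := y) hμ')
  have h5 := (Finset.sum_eq_zero_iff_of_nonneg (hnn (z := y) (z' := y') hμ)).1 (by linarith)
  have h6 : ∀ j, 1 - μ * s j ≠ 0 → y' j - y j = 0 := by
    intro j hj
    have h7 := h5 j (Finset.mem_univ j)
    have h8 := (mul_eq_zero.1 ((mul_eq_zero.1 h7).resolve_left hj)).resolve_left
      (Real.exp_pos _).ne'
    by_contra hne
    linarith [Real.add_one_lt_exp hne]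
  rcases hgen (-μ) with ⟨w, hw, t, ht, hwt⟩ | h
  · by_cases hμ1 : |μ| = 1
    · exfalso
      have hμ2 : μ * μ = 1 := by rw [← abs_mul_abs_self, hμ1, one_mul]
      have h7 : ∀ j, s j = -μ ∨ s j = μ := by
        intro j
        rcases hs j with h | h <;> rcases eq_or_eq_neg_of_abs_eq hμ1 with h' | h' <;> simp [h, h']
      have h8 := hc w hw
      have h9 : ∑ j, (1 - μ * s j) * Real.exp (y j + γ j) * w j = 0 := by
        rw [← sub_eq_zero.2 h8, Finset.mul_sum, ← Finset.sum_sub_distrib]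
        exact Finset.sum_congr rfl fun j _ => by ring
      have h10 : ∑ j, (1 - μ * s j) * Real.exp (y j + γ j) * w j =
          t * (∑ j, Real.exp (y j + γ j) - μ * ∑ j, s j * Real.exp (y j + γ j)) := by
        rw [Finset.mul_sum, ← Finset.sum_sub_distrib, Finset.mul_sum]
        refine Finset.sum_congr rfl fun j _ => ?_
        rcases h7 j with h | h
        · rw [hwt j h]
          ring
        · rw [h, hμ2]
          linear_combination t * Real.exp (y j + γ j) * hμ2
      rw [h10, hF] at h9
      have h11 : 0 < ∑ j, Real.exp (y j + γ j) :=
        Finset.sum_pos (fun j _ => Real.exp_pos _) Finset.univ_nonempty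
      rcases mul_eq_zero.1 h9 with h | h
      · exact ht h
      · linarith
    · funext j
      refine (sub_eq_zero.1 (h6 j fun h => hμ1 ?_)).symm
      have h7 : μ * s j = 1 := by linarith
      have h8 := congrArg abs h7
      rwa [abs_mul, abs_one, show |s j| = 1 by rcases hs j with h | h <;> simp [h], mul_one] at h8
  · refine (sub_eq_zero.1 (h _ (W.sub_mem hy' hy) fun j hj => ?_)).symm
    refine h6 j ?_
    rw [hj]
    nlinarith [mul_self_nonneg μ]

theorem exists_gale_dual_of_critical (W : Submodule ℝ (τ → ℝ)) (s : τ → ℝ)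
    (hs : ∀ j, s j = 1 ∨ s j = -1) (hneg : ∃ j, s j = -1) (w : τ → ℝ) (hw : ∀ j, 0 < w j)
    (hF : ∑ j, s j * w j = 0) {μ : ℝ} (hμ : 1 < |μ|)
    (hc : ∀ h ∈ W, ∑ j, w j * h j = μ * ∑ j, s j * w j * h j) :
    ∃ (v : τ → ℝ) (A ρ : ℝ), 0 < ρ ∧ (∀ j, 0 < v j) ∧
      (∀ h ∈ W, ∑ j, s j * v j * h j = 0) ∧ ∑ j, (1 - s j) / 2 * v j = 1 ∧
      ∑ j, (1 + s j) / 2 * v j = ρ ∧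
      ∀ j, Real.log (v j) = Real.log (w j) - A + (1 + s j) / 2 * Real.log ρ := by
  have hss : ∀ j, s j * s j = 1 := fun j => by rcases hs j with h | h <;> rw [h] <;> norm_num
  set a := ∑ j, (1 - s j) / 2 * w j with ha
  have hap : ∑ j, (1 + s j) / 2 * w j = a := by
    rw [ha, ← sub_eq_zero, ← Finset.sum_sub_distrib, ← hF]
    exact Finset.sum_congr rfl fun j _ => by ring
  have hapos : 0 < a := by
    obtain ⟨j, hj⟩ := hneg
    refine Finset.sum_pos' (fun i _ => mul_nonneg ?_ (hw i).le) ⟨j, Finset.mem_univ j, ?_⟩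
    · rcases hs i with h | h <;> rw [h] <;> norm_num
    · rw [hj]
      linarith [hw j]
  have hμ1 : μ + 1 ≠ 0 := by
    intro h
    rw [show μ = -1 by linarith] at hμ
    norm_num at hμ
  have hρ : 0 < (μ - 1) / (μ + 1) := by
    rcases lt_abs.1 hμ with h | h
    · exact div_pos (by linarith) (by linarith)
    · exact div_pos_of_neg_of_neg (by linarith) (by linarith)
  set ρ := (μ - 1) / (μ + 1) with hρd
  have hv : ∀ j, (μ - s j) / (μ + 1) = if s j = 1 then ρ else 1 := by
    intro j
    rcases hs j with h | h
    · rw [if_pos h, h]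
    · rw [if_neg (by rw [h]; norm_num), h]
      field_simp
      ring
  refine ⟨fun j => (μ - s j) / (μ + 1) * w j / a, Real.log a, ρ, hρ, fun j => ?_, fun h hh => ?_,
    ?_, ?_, fun j => ?_⟩
  · refine div_pos (mul_pos ?_ (hw j)) hapos
    rw [hv]
    split_ifs <;> linarith
  · have h1 := hc h hh
    have h2 : ∀ j, s j * ((μ - s j) / (μ + 1) * w j / a) * h j =
        (μ * (s j * w j * h j) - w j * h j) / ((μ + 1) * a) := fun j => by
      field_simp
      linear_combination (-w j * h j) * hss j
    rw [Finset.sum_congr rfl fun j _ => h2 j, ← Finset.sum_div, Finset.sum_sub_distrib,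
      ← Finset.mul_sum, h1, sub_self, zero_div]
  · have h2 : ∀ j, (1 - s j) / 2 * ((μ - s j) / (μ + 1) * w j / a) = (1 - s j) / 2 * w j / a :=
      fun j => by
        field_simp
        linear_combination w j * hss j
    rw [Finset.sum_congr rfl fun j _ => h2 j, ← Finset.sum_div, div_self hapos.ne']
  · have h2 : ∀ j, (1 + s j) / 2 * ((μ - s j) / (μ + 1) * w j / a) =
        ρ * ((1 + s j) / 2 * w j) / a :=
      fun j => by
        rw [hρd]
        field_simp
        linear_combination (-w j) * hss j
    rw [Finset.sum_congr rfl fun j _ => h2 j, ← Finset.sum_div, ← Finset.mul_sum, hap,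
      mul_div_assoc, div_self hapos.ne', mul_one]
  · change Real.log ((μ - s j) / (μ + 1) * w j / a) = _
    rw [hv]
    rcases hs j with h | h
    · rw [if_pos h, h, Real.log_div (mul_pos hρ (hw j)).ne' hapos.ne',
        Real.log_mul hρ.ne' (hw j).ne']
      ring
    · rw [if_neg (by rw [h]; norm_num), h, one_mul, Real.log_div (hw j).ne' hapos.ne']
      ring

end ExponentialSum

theorem LinearMap.apply_eq_sum_single {k : ℕ} {τ : Type*} (M : (Fin k → ℝ) →ₗ[ℝ] (τ → ℝ))
    (u : Fin k → ℝ) (j : τ) : M u j = ∑ i, M (Pi.single i 1) j * u i := by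
  conv_lhs => rw [pi_eq_sum_univ' u]
  simp [mul_comm]

section Affine

variable {k : ℕ} {τ : Type*}

/-- The polynomial whose evaluation at `u` is the `j`-th coordinate of `v₀ + M u`. -/
noncomputable def affinePoly (v₀ : τ → ℝ) (M : (Fin k → ℝ) →ₗ[ℝ] (τ → ℝ)) (j : τ) :
    MvPolynomial (Fin k) ℝ :=
  MvPolynomial.C (v₀ j) + ∑ i, MvPolynomial.C (M (Pi.single i 1) j) * MvPolynomial.X i

theorem eval_affinePoly (v₀ : τ → ℝ) (M : (Fin k → ℝ) →ₗ[ℝ] (τ → ℝ)) (j : τ) (u : Fin k → ℝ) :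
    MvPolynomial.eval u (affinePoly v₀ M j) = v₀ j + M u j := by
  simp [affinePoly, M.apply_eq_sum_single u j]

theorem totalDegree_affinePoly_le (v₀ : τ → ℝ) (M : (Fin k → ℝ) →ₗ[ℝ] (τ → ℝ)) (j : τ) :
    (affinePoly v₀ M j).totalDegree ≤ 1 := by
  refine (MvPolynomial.totalDegree_add _ _).trans (max_le (by simp) ?_)
  refine MvPolynomial.totalDegree_finsetSum_le fun i _ => ?_
  refine (MvPolynomial.totalDegree_mul _ _).trans ?_
  simp

variable [Fintype τ]

theorem totalDegree_sum_C_mul_affinePoly_le (c v₀ : τ → ℝ) (M : (Fin k → ℝ) →ₗ[ℝ] (τ → ℝ)) :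
    (∑ j, MvPolynomial.C (c j) * affinePoly v₀ M j).totalDegree ≤ 1 := by
  refine MvPolynomial.totalDegree_finsetSum_le fun j _ => ?_
  refine (MvPolynomial.totalDegree_mul _ _).trans ?_
  simpa using totalDegree_affinePoly_le v₀ M j

theorem isCompact_affine_slab (v₀ : τ → ℝ) (M : (Fin k → ℝ) →ₗ[ℝ] (τ → ℝ))
    (hM : Function.Injective M) (R : ℝ) :
    IsCompact {u : Fin k → ℝ | (∀ j, 0 ≤ v₀ j + M u j) ∧ ∑ j, (v₀ j + M u j) ≤ R} := by
  have hcl := LinearMap.isClosedEmbedding_of_injective (LinearMap.ker_eq_bot.2 hM)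
  have hc : ∀ j, Continuous fun u => v₀ j + M u j := fun j =>
    continuous_const.add ((continuous_apply j).comp hcl.continuous)
  refine IsCompact.of_isClosed_subset
    (hcl.isCompact_preimage (isCompact_Icc (a := fun j => -v₀ j) (b := fun j => R - v₀ j))) ?_ ?_
  · have h1 : IsClosed {u : Fin k → ℝ | ∀ j, 0 ≤ v₀ j + M u j} := by
      simp only [Set.ofPred_forall]
      exact isClosed_iInter fun j => isClosed_le continuous_const (hc j)
    exact h1.inter (isClosed_le (continuous_finsetSum _ fun j _ => hc j) continuous_const)
  · rintro u ⟨h1, h2⟩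
    refine ⟨fun j => by linarith [h1 j], fun j => ?_⟩
    have := Finset.single_le_sum (f := fun j => v₀ j + M u j) (fun i _ => h1 i) (Finset.mem_univ j)
    simp only at this ⊢
    linarith

end Affine

section ExponentialSum

variable {τ : Type*} [Fintype τ]

theorem exists_affine_parametrization (W : Submodule ℝ (τ → ℝ)) (n k : ℕ)
    (hn : Module.finrank ℝ W = n) (hk : Fintype.card τ = n + k + 1) (s : τ → ℝ)
    (hs : ∀ j, s j = 1 ∨ s j = -1) (hneg : ∃ j, s j = -1) (β : τ → ℝ) (hβ0 : ∀ j, 0 < β j)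
    (hβ : ∀ h ∈ W, β ⬝ᵥ h = 0) :
    ∃ (v₀ : τ → ℝ) (M : (Fin k → ℝ) →ₗ[ℝ] (τ → ℝ)), Function.Injective M ∧
      ∀ v : τ → ℝ, (∀ h ∈ W, ∑ j, s j * v j * h j = 0) → ∑ j, (1 - s j) / 2 * v j = 1 →
        ∃ u, ∀ j, v₀ j + M u j = v j := by
  have hss : ∀ j, s j * s j = 1 := fun j => by rcases hs j with h | h <;> rw [h] <;> norm_num
  have hp : 0 < β ⬝ᵥ fun j => (1 - s j) / 2 := by
    obtain ⟨j, hj⟩ := hneg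
    refine Finset.sum_pos' (fun i _ => mul_nonneg (hβ0 i).le ?_) ⟨j, Finset.mem_univ j, ?_⟩
    · rcases hs i with h | h <;> norm_num [h]
    · norm_num [hj, hβ0 j]
  set c := β ⬝ᵥ fun j => (1 - s j) / 2 with hc
  obtain ⟨e, he, he'⟩ := exists_injective_range_eq_dotProduct_orthogonal_and W n k hn hk β
    (fun j => (1 - s j) / 2) hβ hp.ne'
  refine ⟨fun j => -(s j * β j / c), (LinearMap.mulLeft ℝ s).comp e, ?_, fun v hv hv' => ?_⟩
  · intro a b hab
    refine he (funext fun j => ?_)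
    have h1 : s j * e a j = s j * e b j := congrFun hab j
    calc e a j = s j * (s j * e a j) := by rw [← mul_assoc, hss, one_mul]
      _ = e b j := by rw [h1, ← mul_assoc, hss, one_mul]
  · obtain ⟨u, hu⟩ := (he' fun j => s j * v j + β j / c).2 ⟨fun h hh => by
      have h1 := hβ h hh
      simp only [dotProduct] at h1 ⊢
      simp only [add_mul, Finset.sum_add_distrib, hv h hh, zero_add, div_mul_eq_mul_div,
        ← Finset.sum_div, h1, zero_div], by
      have h2 : ∀ j, (s j * v j + β j / c) * ((1 - s j) / 2) =
          β j * ((1 - s j) / 2) / c - (1 - s j) / 2 * v j := fun j => by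
        linear_combination (-v j / 2) * hss j
      simp only [dotProduct] at hc ⊢
      rw [Finset.sum_congr rfl fun j _ => h2 j, Finset.sum_sub_distrib, ← Finset.sum_div, ← hc,
        hv', div_self hp.ne', sub_self]⟩
    refine ⟨u, fun j => ?_⟩
    simp only [LinearMap.comp_apply, hu, LinearMap.mulLeft_apply, Pi.mul_apply]
    linear_combination v j * hss j

theorem exists_null_set_card_critical_le [DecidableEq τ] (W : Submodule ℝ (τ → ℝ)) (n k : ℕ)
    (hn : Module.finrank ℝ W = n) (hk : Fintype.card τ = n + k + 1) (s : τ → ℝ)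
    (hs : ∀ j, s j = 1 ∨ s j = -1) (hneg : ∃ j, s j = -1) (β : τ → ℝ) (hβ0 : ∀ j, 0 < β j)
    (hβ : ∀ h ∈ W, β ⬝ᵥ h = 0) (b : Fin k → τ → ℝ) (hb : ∀ i, ∀ h ∈ W, b i ⬝ᵥ h = 0)
    (hb1 : ∀ i, ∑ j, b i j = 0) :
    ∃ Z : Set (Fin k → ℝ), MeasureTheory.volume Z = 0 ∧ ∀ γ : τ → ℝ, (fun i => b i ⬝ᵥ γ) ∉ Z →
      ∀ S : Finset (τ → ℝ), (∀ y ∈ S, y ∈ W ∧ ∑ j, s j * Real.exp (y j + γ j) = 0 ∧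
        ∃ μ : ℝ, 1 < |μ| ∧ ∀ h ∈ W, ∑ j, Real.exp (y j + γ j) * h j =
          μ * ∑ j, s j * Real.exp (y j + γ j) * h j) →
      (S.card : ℝ) ≤ rolleBound (n + k + 3) k (n + 2) := by
  obtain ⟨v₀, M, hM, hv₀⟩ := exists_affine_parametrization W n k hn hk s hs hneg β hβ0 hβ
  let L : Option τ → MvPolynomial (Fin k) ℝ := fun o =>
    o.elim (∑ j, MvPolynomial.C ((1 + s j) / 2) * affinePoly v₀ M j) (affinePoly v₀ M)
  let b' : Fin k → Option τ → ℝ := fun i o => o.elim (-∑ j, (1 + s j) / 2 * b i j) (b i)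
  let σ : MvPolynomial (Fin k) ℝ := ∑ j, MvPolynomial.C 1 * affinePoly v₀ M j
  have hLs : ∀ u j, MvPolynomial.eval u (L (some j)) = v₀ j + M u j := fun u j =>
    eval_affinePoly v₀ M j u
  have hLn : ∀ u, MvPolynomial.eval u (L none) = ∑ j, (1 + s j) / 2 * (v₀ j + M u j) := fun u => by
    simp [L, eval_affinePoly]
  have hσe : ∀ u, MvPolynomial.eval u σ = ∑ j, (v₀ j + M u j) := fun u => by
    simp [σ, eval_affinePoly]
  have hLc : ∀ o, Continuous fun u => MvPolynomial.eval u (L o) := fun o =>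
    MvPolynomial.continuous_eval _
  have hL : ∀ o, (L o).totalDegree ≤ 1
    | none => totalDegree_sum_C_mul_affinePoly_le _ v₀ M
    | some j => totalDegree_affinePoly_le v₀ M j
  have hcomp : ∀ δ > 0, ∀ R, IsCompact {x | (∀ j, δ ≤ MvPolynomial.eval x (L j)) ∧
      MvPolynomial.eval x σ ≤ R} := by
    intro δ hδ R
    refine IsCompact.of_isClosed_subset (isCompact_affine_slab v₀ M hM R) ?_ ?_
    · have h1 : IsClosed {u : Fin k → ℝ | ∀ o, δ ≤ MvPolynomial.eval u (L o)} := by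
        simp only [Set.ofPred_forall]
        exact isClosed_iInter fun o => isClosed_le continuous_const (hLc o)
      exact h1.inter (isClosed_le (MvPolynomial.continuous_eval σ) continuous_const)
    · rintro u ⟨h1, h2⟩
      exact ⟨fun j => by rw [← hLs]; exact hδ.le.trans (h1 _), by rw [← hσe]; exact h2⟩
  refine ⟨_, volume_critical_values_logPolyMap L b' 0, fun γ hγ S hS => ?_⟩
  have hex : ∀ y ∈ S, ∃ u, (∀ o, 0 < MvPolynomial.eval u (L o)) ∧
      logPolyMap L b' 0 u = (fun i => b i ⬝ᵥ γ) ∧ ∃ A ρ : ℝ, ρ = MvPolynomial.eval u (L none) ∧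
        ∀ j, Real.log (MvPolynomial.eval u (L (some j))) =
          y j + γ j - A + (1 + s j) / 2 * Real.log ρ := by
    intro y hy
    obtain ⟨hyW, hyF, μ, hμ, hc⟩ := hS y hy
    obtain ⟨v, A, ρ, hρ, hv, hvW, hv1, hvρ, hlog⟩ := exists_gale_dual_of_critical W s hs hneg
      (fun j => Real.exp (y j + γ j)) (fun j => Real.exp_pos _) hyF hμ hc
    obtain ⟨u, hu⟩ := hv₀ v hvW hv1
    have h1 : ∀ j, MvPolynomial.eval u (L (some j)) = v j := fun j => by rw [hLs, hu]
    have h2 : MvPolynomial.eval u (L none) = ρ := by simp only [hLn, hu, hvρ]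
    simp only [Real.log_exp] at hlog
    refine ⟨u, ?_, ?_, A, ρ, h2.symm, fun j => by rw [h1, hlog]⟩
    · rintro (_ | j)
      · rwa [h2]
      · rw [h1]
        exact hv j
    · funext i
      simp only [logPolyMap, Fintype.sum_option, h1, h2, hlog, Pi.zero_apply, map_zero, add_zero]
      have h3 : ∀ j, b' i (some j) * (y j + γ j - A + (1 + s j) / 2 * Real.log ρ) =
          b i j * y j + b i j * γ j - b i j * A + (1 + s j) / 2 * b i j * Real.log ρ := fun j => by
        change b i j * _ = _
        ring
      have h4 : b' i none = -∑ j, (1 + s j) / 2 * b i j := rfl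
      have h5 := hb i y hyW
      simp only [dotProduct] at h5 ⊢
      rw [Finset.sum_congr rfl fun j _ => h3 j, h4]
      simp only [Finset.sum_add_distrib, Finset.sum_sub_distrib, ← Finset.sum_mul, h5, hb1]
      ring
  choose! u hu hmap A ρ hρ hlog using hex
  have hτ : Nonempty τ := ⟨hneg.choose⟩
  have hinj : Set.InjOn u S := by
    intro y hy y' hy' h
    have h1 : ∀ j, y j - y' j = A y - A y' := fun j => by
      have h2 := hlog y hy j
      have h3 := hlog y' hy' j
      rw [hρ y hy] at h2
      rw [hρ y' hy', ← h] at h3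
      linarith
    have h4 := hβ _ (W.sub_mem (hS y hy).1 (hS y' hy').1)
    simp only [dotProduct, Pi.sub_apply, h1, ← Finset.sum_mul] at h4
    have h5 : 0 < ∑ j, β j := Finset.sum_pos (fun j _ => hβ0 j) Finset.univ_nonempty
    funext j
    have := h1 j
    rw [(mul_eq_zero.1 h4).resolve_left h5.ne'] at this
    linarith
  have hfin := card_le_prod_mul_rolleBound L hL σ (totalDegree_sum_C_mul_affinePoly_le _ v₀ M)
    hcomp k Finset.univ (by simp) b' 0 0 (n + 2) (by omega) (by simp) (by simp) (by simp)
    (by simp [hk]; omega) (fun i => b i ⬝ᵥ γ) (S.image u) (fun x hx => by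
      obtain ⟨y, hy, rfl⟩ := Finset.mem_image.1 hx
      exact ⟨hu y hy, hmap y hy, fun hdet => hγ ⟨u y, ⟨hu y hy, hdet⟩, hmap y hy⟩⟩)
  rw [Finset.card_image_of_injOn hinj] at hfin
  simpa [hk, add_assoc] using hfin

end ExponentialSum

section PointConfiguration

variable {τ : Type*} [Fintype τ] {N : ℕ}

theorem finrank_range_mulVecLin_sup_span_one [Nonempty τ] (A : τ → Fin N → ℝ) :
    Module.finrank ℝ ↥(LinearMap.range (Matrix.of A).mulVecLin ⊔
      Submodule.span ℝ {(1 : τ → ℝ)}) = Module.finrank ℝ (vectorSpan ℝ (Set.range A)) + 1 := by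
  classical
  obtain ⟨a₀⟩ := ‹Nonempty τ›
  set M₀ : Matrix τ (Fin N) ℝ := Matrix.of fun a => A a - A a₀ with hM₀
  have hM : ∀ ζ, M₀.mulVecLin ζ = (Matrix.of A).mulVecLin ζ - (A a₀ ⬝ᵥ ζ) • (1 : τ → ℝ) := by
    intro ζ
    funext a
    simp only [hM₀, Matrix.mulVec, Matrix.mulVecLin_apply, Matrix.of_apply, Pi.sub_apply,
      Pi.smul_apply, Pi.one_apply, smul_eq_mul, mul_one]
    exact sub_dotProduct (A a) (A a₀) ζ
  have h1 : LinearMap.range (Matrix.of A).mulVecLin ⊔ Submodule.span ℝ {(1 : τ → ℝ)} =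
      LinearMap.range M₀.mulVecLin ⊔ Submodule.span ℝ {(1 : τ → ℝ)} := by
    have hone : ∀ (V : Submodule ℝ (τ → ℝ)) (t : ℝ),
        t • (1 : τ → ℝ) ∈ V ⊔ Submodule.span ℝ {(1 : τ → ℝ)} := fun V t =>
      Submodule.mem_sup_right (Submodule.smul_mem _ _ (Submodule.mem_span_singleton_self _))
    refine le_antisymm (sup_le ?_ le_sup_right) (sup_le ?_ le_sup_right)
    · rintro _ ⟨ζ, rfl⟩
      rw [← sub_add_cancel ((Matrix.of A).mulVecLin ζ) ((A a₀ ⬝ᵥ ζ) • (1 : τ → ℝ)), ← hM]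
      exact Submodule.add_mem _ (Submodule.mem_sup_left ⟨ζ, rfl⟩) (hone _ _)
    · rintro _ ⟨ζ, rfl⟩
      rw [hM]
      exact Submodule.sub_mem _ (Submodule.mem_sup_left ⟨ζ, rfl⟩) (hone _ _)
  have h2 : Disjoint (LinearMap.range M₀.mulVecLin) (Submodule.span ℝ {(1 : τ → ℝ)}) := by
    rw [Submodule.disjoint_span_singleton]
    rintro ⟨ζ, hζ⟩
    have h3 := congrFun hζ a₀
    simp [hM₀, Matrix.mulVec] at h3
  have h4 := Submodule.finrank_sup_add_finrank_inf_eq (LinearMap.range M₀.mulVecLin)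
    (Submodule.span ℝ {(1 : τ → ℝ)})
  have h5 : (1 : τ → ℝ) ≠ 0 := fun h => one_ne_zero (congrFun h a₀)
  rw [h2.eq_bot, finrank_bot, finrank_span_singleton h5, add_zero] at h4
  rw [h1, h4]
  congr 1
  have h6 := M₀.rank_eq_finrank_span_row
  rw [Matrix.rank] at h6
  rw [h6, vectorSpan_range_eq_span_range_vsub_right ℝ A a₀]
  rfl

theorem exists_pos_dotProduct_ne_zero {α : Type*} [Finite α] (h : α → τ → ℝ) (hh : ∀ a, h a ≠ 0) :
    ∃ β : τ → ℝ, (∀ j, 0 < β j) ∧ ∀ a, β ⬝ᵥ h a ≠ 0 := by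
  have hU : IsOpen {β : τ → ℝ | ∀ j, 0 < β j} := by
    simp only [Set.ofPred_forall]
    exact isOpen_iInter_of_finite fun j => isOpen_lt continuous_const (continuous_apply j)
  obtain ⟨β, hβ, hβ'⟩ := exists_mem_notMem_of_isOpen hU ⟨1, fun _ => one_pos⟩
    (fun a => {β : τ → ℝ | β ⬝ᵥ h a = 0}) fun a => by
      let V : Submodule ℝ (τ → ℝ) := LinearMap.ker (dotProductBilin ℝ ℝ (h a))
      have hV : V ≠ ⊤ := by
        intro hV
        have h1 : h a ∈ V := hV ▸ Submodule.mem_top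
        exact hh a (dotProduct_self_eq_zero.1 h1)
      convert MeasureTheory.Measure.addHaar_submodule MeasureTheory.volume V hV using 2
      ext β
      simp [V, dotProduct_comm]
  exact ⟨β, hβ, hβ'⟩

theorem exists_transversal_weight [Nonempty τ] (H : Submodule ℝ (τ → ℝ)) (h1 : (1 : τ → ℝ) ∈ H)
    (s : τ → ℝ) (hs : ∀ j, s j = 1 ∨ s j = -1) :
    ∃ β : τ → ℝ, (∀ j, 0 < β j) ∧ ∀ e : ℝ,
      (∃ w ∈ H, β ⬝ᵥ w = 0 ∧ ∃ t : ℝ, t ≠ 0 ∧ ∀ j, s j = e → w j = t) ∨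
        ∀ w ∈ H, (∀ j, s j = e → w j = 0) → w = 0 := by
  have h10 : (1 : τ → ℝ) ≠ 0 := one_ne_zero
  have hex : ∀ a : ({1, -1} : Set ℝ), ∃ h : τ → ℝ, h ≠ 0 ∧
      ((h ∈ H ∧ ∀ j, s j = a → h j = 0) ∨ ∀ w ∈ H, (∀ j, s j = a → w j = 0) → w = 0) := by
    intro a
    by_cases ha : ∀ w ∈ H, (∀ j, s j = a → w j = 0) → w = 0
    · exact ⟨1, h10, Or.inr ha⟩
    · push Not at ha
      obtain ⟨w, hw, hw', hw0⟩ := ha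
      exact ⟨w, hw0, Or.inl ⟨hw, hw'⟩⟩
  choose h hh hh' using hex
  obtain ⟨β, hβ, hβh⟩ := exists_pos_dotProduct_ne_zero h hh
  refine ⟨β, hβ, fun e => ?_⟩
  by_cases he : e ∈ ({1, -1} : Set ℝ)
  · refine (hh' ⟨e, he⟩).imp_left fun ⟨hH, hz⟩ => ?_
    have hβ1 : β ⬝ᵥ 1 ≠ 0 := by
      rw [dotProduct_one]
      exact (Finset.sum_pos (fun j _ => hβ j) Finset.univ_nonempty).ne'
    refine ⟨h ⟨e, he⟩ - (β ⬝ᵥ h ⟨e, he⟩ / β ⬝ᵥ 1) • 1, H.sub_mem hH (H.smul_mem _ h1), ?_,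
      -(β ⬝ᵥ h ⟨e, he⟩ / β ⬝ᵥ 1), neg_ne_zero.2 (div_ne_zero (hβh _) hβ1), fun j hj => ?_⟩
    · rw [dotProduct_sub, dotProduct_smul, smul_eq_mul, div_mul_cancel₀ _ hβ1, sub_self]
    · simp [hz j hj]
  · exact Or.inl ⟨0, H.zero_mem, dotProduct_zero _, 1, one_ne_zero, fun j hj =>
      absurd (by rcases hs j with h' | h' <;> simp [← hj, h']) he⟩

theorem finrank_inf_ker_dotProduct [Nonempty τ] (H : Submodule ℝ (τ → ℝ)) (n : ℕ)
    (hH : Module.finrank ℝ H = n + 1) (h1 : (1 : τ → ℝ) ∈ H) (β : τ → ℝ) (hβ : ∀ j, 0 < β j) :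
    Module.finrank ℝ ↥(H ⊓ LinearMap.ker (dotProductBilin ℝ ℝ β)) = n := by
  have hβ1 : β ⬝ᵥ 1 ≠ 0 := by
    rw [dotProduct_one]
    exact (Finset.sum_pos (fun j _ => hβ j) Finset.univ_nonempty).ne'
  set W := H ⊓ LinearMap.ker (dotProductBilin ℝ ℝ β) with hW
  have h2 : Disjoint W (Submodule.span ℝ {(1 : τ → ℝ)}) := by
    rw [Submodule.disjoint_span_singleton]
    exact fun h => absurd h.2 hβ1
  have h3 : W ⊔ Submodule.span ℝ {(1 : τ → ℝ)} = H := by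
    refine le_antisymm (sup_le inf_le_left ((Submodule.span_singleton_le_iff_mem _ _).2 h1))
      fun w hw => ?_
    rw [← sub_add_cancel w ((β ⬝ᵥ w / β ⬝ᵥ 1) • (1 : τ → ℝ))]
    refine Submodule.add_mem_sup ⟨H.sub_mem hw (H.smul_mem _ h1), ?_⟩
      (Submodule.smul_mem _ _ (Submodule.mem_span_singleton_self _))
    change β ⬝ᵥ _ = 0
    rw [dotProduct_sub, dotProduct_smul, smul_eq_mul, div_mul_cancel₀ _ hβ1, sub_self]
  have h4 := Submodule.finrank_sup_add_finrank_inf_eq W (Submodule.span ℝ {(1 : τ → ℝ)})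
  rw [h2.eq_bot, finrank_bot, finrank_span_singleton one_ne_zero, h3] at h4
  omega

end PointConfiguration

theorem rolleBound_nonneg (F r : ℕ) : ∀ D, 0 ≤ rolleBound F r D := by
  induction r with
  | zero => intro D; simp [rolleBound]
  | succ r ih =>
    intro D
    have := ih (2 * D)
    have := ih (D + 1)
    simp only [rolleBound]
    positivity

section ExponentialSum

variable {τ : Type*} [Fintype τ]

theorem exists_dotProduct_rightInverse {k : ℕ} (e : (Fin k → ℝ) →ₗ[ℝ] (τ → ℝ))
    (he : Function.Injective e) :
    ∃ ρ : (Fin k → ℝ) →ₗ[ℝ] (τ → ℝ), ∀ c i, e (Pi.single i 1) ⬝ᵥ ρ c = c i := by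
  classical
  obtain ⟨l, hl⟩ := e.exists_leftInverse_of_injective (LinearMap.ker_eq_bot.2 he)
  refine ⟨LinearMap.pi fun j => dotProductBilin ℝ ℝ (l (Pi.single j 1)), fun c i => ?_⟩
  have h1 : l (e (Pi.single i 1)) = Pi.single i 1 := LinearMap.congr_fun hl _
  rw [pi_eq_sum_univ' (e (Pi.single i 1)), map_sum] at h1
  simp only [map_smul] at h1
  have h2 := congrArg (fun v => v ⬝ᵥ c) h1
  simp only [sum_dotProduct, smul_dotProduct, single_dotProduct, one_mul] at h2
  exact h2

theorem contDiff_expSum (W : Submodule ℝ (τ → ℝ)) (a : τ → ℝ) :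
    ContDiff ℝ 1 fun p : W × (τ → ℝ) => ∑ j, a j * Real.exp ((p.1 : τ → ℝ) j + p.2 j) := by
  refine ContDiff.sum fun j _ => contDiff_const.mul (Real.contDiff_exp.comp (ContDiff.add ?_ ?_))
  · exact (((LinearMap.proj j).comp W.subtype).toContinuousLinearMap.contDiff).comp contDiff_fst
  · exact (contDiff_apply ℝ ℝ j).comp contDiff_snd

theorem fderiv_expSum_apply (W : Submodule ℝ (τ → ℝ)) (a : τ → ℝ) (y h : W) (γ : τ → ℝ) :
    fderiv ℝ (fun p : W × (τ → ℝ) => ∑ j, a j * Real.exp ((p.1 : τ → ℝ) j + p.2 j)) (y, γ) (h, 0) =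
      ∑ j, a j * Real.exp ((y : τ → ℝ) j + γ j) * (h : τ → ℝ) j := by
  have h1 : ∀ j, HasFDerivAt (fun p : W × (τ → ℝ) => (p.1 : τ → ℝ) j + p.2 j)
      ((((LinearMap.proj j).comp W.subtype).toContinuousLinearMap).comp
        (ContinuousLinearMap.fst ℝ W (τ → ℝ)) +
        (ContinuousLinearMap.proj (R := ℝ) (φ := fun _ : τ => ℝ) j).comp
          (ContinuousLinearMap.snd ℝ W (τ → ℝ))) (y, γ) := fun j =>
    (ContinuousLinearMap.hasFDerivAt _).congr_of_eventuallyEq (Eventually.of_forall fun p => rfl)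
  have h2 := HasFDerivAt.fun_sum (u := Finset.univ) fun j _ => ((h1 j).exp).const_mul (a j)
  rw [h2.fderiv]
  simp [mul_assoc]

theorem isCompact_sum_exp_le (W : Submodule ℝ (τ → ℝ)) (β : τ → ℝ) (hβ0 : ∀ j, 0 < β j)
    (hβ : ∀ h ∈ W, β ⬝ᵥ h = 0) (γ : τ → ℝ) (t : ℝ) :
    IsCompact {z : W | ∑ j, Real.exp ((z : τ → ℝ) j + γ j) ≤ t} := by
  have hcl : Topology.IsClosedEmbedding (Subtype.val : W → τ → ℝ) :=
    W.closed_of_finiteDimensional.isClosedEmbedding_subtypeVal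
  have hup : ∀ z : W, ∑ j, Real.exp ((z : τ → ℝ) j + γ j) ≤ t → ∀ j, (z : τ → ℝ) j ≤ t - γ j := by
    intro z hz j
    have h1 := Finset.single_le_sum (f := fun j => Real.exp ((z : τ → ℝ) j + γ j))
      (fun i _ => (Real.exp_pos _).le) (Finset.mem_univ j)
    linarith [Real.add_one_le_exp ((z : τ → ℝ) j + γ j)]
  refine IsCompact.of_isClosed_subset (hcl.isCompact_preimage (isCompact_Icc
    (a := fun j => (t - γ j) - (∑ i, β i * (t - γ i)) / β j) (b := fun j => t - γ j))) ?_ ?_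
  · refine isClosed_le (continuous_finsetSum _ fun j _ => Real.continuous_exp.comp
      (((continuous_apply j).comp continuous_subtype_val).add continuous_const)) continuous_const
  · intro z hz
    refine ⟨fun j => ?_, hup z hz⟩
    have h1 := hβ z z.2
    have h2 := Finset.single_le_sum (f := fun i => β i * (t - γ i) - β i * (z : τ → ℝ) i)
      (fun i _ => by nlinarith [hup z hz i, hβ0 i]) (Finset.mem_univ j)
    simp only [Finset.sum_sub_distrib, dotProduct] at h1 h2
    rw [h1, sub_zero, ← mul_sub, mul_comm, ← le_div_iff₀ (hβ0 j)] at h2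
    simp only
    linarith

theorem card_le_one_add_rolleBound [DecidableEq τ] (W : Submodule ℝ (τ → ℝ)) (n k : ℕ)
    (hn : Module.finrank ℝ W = n) (hk : Fintype.card τ = n + k + 1) (s : τ → ℝ)
    (hs : ∀ j, s j = 1 ∨ s j = -1) (β : τ → ℝ) (hβ0 : ∀ j, 0 < β j)
    (hβ : ∀ h ∈ W, β ⬝ᵥ h = 0)
    (hgen : ∀ e : ℝ, (∃ w ∈ W, ∃ t : ℝ, t ≠ 0 ∧ ∀ j, s j = e → w j = t) ∨
      ∀ w ∈ W, (∀ j, s j = e → w j = 0) → w = 0)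
    (γ : τ → ℝ) (hreg : ∀ z : W, ∑ j, s j * Real.exp ((z : τ → ℝ) j + γ j) = 0 →
      ∃ h : W, ∑ j, s j * Real.exp ((z : τ → ℝ) j + γ j) * (h : τ → ℝ) j ≠ 0)
    (S : Finset W) (hS : ∀ z ∈ S, ∑ j, s j * Real.exp ((z : τ → ℝ) j + γ j) = 0)
    (hd : ∀ x ∈ S, ∀ y ∈ S, y ∈ connectedComponentIn
      {z : W | ∑ j, s j * Real.exp ((z : τ → ℝ) j + γ j) = 0} x → x = y) :
    (S.card : ℝ) ≤ 1 + rolleBound (n + k + 3) k (n + 2) := by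
  have hτ : Nonempty τ := Fintype.card_pos_iff.1 (by omega)
  rcases S.eq_empty_or_nonempty with rfl | ⟨z₀, hz₀⟩
  · have := rolleBound_nonneg (n + k + 3) k (n + 2)
    simp only [Finset.card_empty, Nat.cast_zero]
    linarith
  have hneg : ∃ j, s j = -1 := by
    by_contra! h
    have h1 : 0 < ∑ j, s j * Real.exp ((z₀ : τ → ℝ) j + γ j) :=
      Finset.sum_pos (fun j _ => by rw [(hs j).resolve_right (h j), one_mul]; exact Real.exp_pos _)
        Finset.univ_nonempty
    exact h1.ne' (hS z₀ hz₀)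
  have hβ1 : β ⬝ᵥ (fun _ => 1) ≠ 0 := by
    simp only [dotProduct, mul_one]
    exact (Finset.sum_pos (fun j _ => hβ0 j) Finset.univ_nonempty).ne'
  obtain ⟨e, he, he'⟩ := exists_injective_range_eq_dotProduct_orthogonal_and W n k hn hk β _ hβ hβ1
  obtain ⟨ρ, hρ⟩ := exists_dotProduct_rightInverse e he
  have hb := fun i => (he' (e (Pi.single i 1))).1 ⟨_, rfl⟩
  obtain ⟨Z, hZ, hZ'⟩ := exists_null_set_card_critical_le W n k hn hk s hs hneg β hβ0 hβ
    (fun i => e (Pi.single i 1)) (fun i => (hb i).1) fun i => by simpa [dotProduct] using (hb i).2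
  have hev := eventually_exists_card_critical_points
    (F := fun p : W × (τ → ℝ) => ∑ j, s j * Real.exp ((p.1 : τ → ℝ) j + p.2 j))
    (T := fun p : W × (τ → ℝ) => ∑ j, 1 * Real.exp ((p.1 : τ → ℝ) j + p.2 j))
    (contDiff_expSum W s) (contDiff_expSum W fun _ => 1) γ
    (fun z hz => by simpa only [fderiv_expSum_apply] using hreg z hz)
    (fun t => by simpa only [one_mul] using isCompact_sum_exp_le W β hβ0 hβ γ t) S hS hd
  simp only [fderiv_expSum_apply W s, fderiv_expSum_apply W fun _ => 1] at hev
  simp only [one_mul] at hev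
  set c₀ : Fin k → ℝ := fun i => e (Pi.single i 1) ⬝ᵥ γ with hc₀
  have hcont : Tendsto (fun c => γ + ρ (c - c₀)) (𝓝 c₀) (𝓝 γ) := by
    have h1 : Continuous fun c => γ + ρ (c - c₀) :=
      continuous_const.add (ρ.continuous_of_finiteDimensional.comp
        (continuous_id.sub continuous_const))
    simpa using h1.tendsto c₀
  obtain ⟨U, hU, hUo, hcU⟩ := eventually_nhds_iff.1 (hcont.eventually hev)
  obtain ⟨c, hcU', hcZ⟩ := exists_mem_notMem_of_isOpen hUo ⟨c₀, hcU⟩ (fun _ : Unit => Z)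
    fun _ => hZ
  obtain ⟨S', hS'c, hS'⟩ := hU c hcU'
  set γ' := γ + ρ (c - c₀) with hγ'
  have hcγ : (fun i => e (Pi.single i 1) ⬝ᵥ γ') = c := by
    funext i
    rw [hγ', dotProduct_add, hρ]
    simp [hc₀]
  classical
  let P : W → Prop := fun y => ∃ μ : ℝ, |μ| ≤ 1 ∧ ∀ h : W,
    ∑ j, Real.exp ((y : τ → ℝ) j + γ' j) * (h : τ → ℝ) j =
      μ * ∑ j, s j * Real.exp ((y : τ → ℝ) j + γ' j) * (h : τ → ℝ) j
  have h1 : (S'.filter P).card ≤ 1 := by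
    rw [Finset.card_le_one]
    intro y hy y' hy'
    obtain ⟨hyS, μ, hμ, hc⟩ := Finset.mem_filter.1 hy
    obtain ⟨hyS', μ', hμ', hc'⟩ := Finset.mem_filter.1 hy'
    exact Subtype.ext (eq_of_critical_of_abs_le_one W s hs hgen γ' y.2 y'.2 (hS' y hyS).1
      (hS' y' hyS').1 hμ hμ' (fun h hh => hc ⟨h, hh⟩) fun h hh => hc' ⟨h, hh⟩)
  have h2 : ((S'.filter fun y => ¬P y).card : ℝ) ≤ rolleBound (n + k + 3) k (n + 2) := by
    have h3 := hZ' γ' (by rw [hcγ]; exact hcZ ()) ((S'.filter fun y => ¬P y).image Subtype.val) ?_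
    · rwa [Finset.card_image_of_injective _ Subtype.val_injective] at h3
    · intro y hy
      obtain ⟨y, hy', rfl⟩ := Finset.mem_image.1 hy
      obtain ⟨hyS, hyP⟩ := Finset.mem_filter.1 hy'
      obtain ⟨hF, μ, hμ⟩ := hS' y hyS
      exact ⟨y.2, hF, μ, not_le.1 fun h => hyP ⟨μ, h, hμ⟩, fun h hh => hμ ⟨h, hh⟩⟩
  have h4 : S.card = (S'.filter P).card + (S'.filter fun y => ¬P y).card := by
    rw [← hS'c, Finset.card_filter_add_card_filter_not]
  have h5 : ((S'.filter P).card : ℝ) ≤ 1 := by exact_mod_cast h1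
  rw [h4]
  push_cast
  linarith

end ExponentialSum

theorem card_zeros_expSum_lt {τ : Type*} (c l : τ → ℝ) (J : Finset τ) (hJ : J.Nonempty) :
    (∀ j ∈ J, c j ≠ 0) → Set.InjOn l J →
      ∀ S : Finset ℝ, (∀ t ∈ S, ∑ j ∈ J, c j * Real.exp (l j * t) = 0) → S.card + 1 ≤ J.card := by
  classical
  induction hJ using Finset.Nonempty.cons_induction generalizing c l with
  | singleton a =>
    intro hc _ S hS
    rcases S.eq_empty_or_nonempty with rfl | ⟨t, ht⟩
    · simp
    · have h1 := hS t ht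
      rw [Finset.sum_singleton] at h1
      exact absurd h1 (mul_ne_zero (hc a (by simp)) (Real.exp_pos _).ne')
  | cons a J ha hJ ih =>
    intro hc hl S hS
    have hla : ∀ j ∈ J, l j - l a ≠ 0 := fun j hj h => ha (by
      rwa [← hl (by simp [hj]) (by simp) (sub_eq_zero.1 h)])
    have ih' := ih (fun j => c j * (l j - l a)) (fun j => l j - l a)
      (fun j hj => mul_ne_zero (hc j (by simp [hj])) (hla j hj))
      (fun i hi j hj hij => hl (by simp [Finset.mem_coe.1 hi]) (by simp [Finset.mem_coe.1 hj])
        (by simpa using hij))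
    obtain ⟨T, hT, -⟩ := Set.exists_finset_eq_card_le (B := J.card)
      (A := {t : ℝ | ∑ j ∈ J, c j * (l j - l a) * Real.exp ((l j - l a) * t) = 0})
      (fun S' hS' => by
        have := ih' S' fun t ht => hS' ht
        exact_mod_cast (Nat.le_succ _).trans this)
    have hTz := ih' T fun t ht => by
      have : t ∈ (T : Set ℝ) := ht
      rwa [hT] at this
    let g : ℝ → ℝ := fun t => c a + ∑ j ∈ J, c j * Real.exp ((l j - l a) * t)
    have hg : ∀ t, HasDerivAt g (∑ j ∈ J, c j * (l j - l a) * Real.exp ((l j - l a) * t)) t := by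
      intro t
      refine HasDerivAt.const_add _ (HasDerivAt.fun_sum fun j _ => ?_)
      have h1 : HasDerivAt (fun t : ℝ => (l j - l a) * t) (l j - l a) t := by
        simpa using (hasDerivAt_id t).const_mul (l j - l a)
      exact ((h1.exp).const_mul (c j)).congr_deriv (by ring)
    have hgS : ∀ t ∈ S, g t = 0 := by
      intro t ht
      have h1 := hS t ht
      have h2 : Real.exp (l a * t) * g t = 0 := by
        rw [← h1, Finset.sum_cons, mul_add, Finset.mul_sum, mul_comm]
        refine congrArg₂ _ rfl (Finset.sum_congr rfl fun j _ => ?_)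
        rw [mul_left_comm, ← Real.exp_add]
        congr 2
        ring
      exact (mul_eq_zero.1 h2).resolve_left (Real.exp_pos _).ne'
    have h3 := Finset.card_le_of_interleaved (s := S) (t := T) fun x hx y hy hxy _ => by
      obtain ⟨z, hz, hz'⟩ := exists_hasDerivAt_eq_zero hxy
        (fun t _ => (hg t).continuousAt.continuousWithinAt) ((hgS x hx).trans (hgS y hy).symm)
        (fun t _ => hg t)
      refine ⟨z, ?_, hz.1, hz.2⟩
      rw [← Finset.mem_coe, hT]
      exact hz'
    rw [Finset.card_cons]
    omega

theorem card_zeros_lt_of_finrank_eq_one {τ : Type*} [Fintype τ] [Nonempty τ]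
    (W : Submodule ℝ (τ → ℝ)) (hn : Module.finrank ℝ W = 1) (s : τ → ℝ) (hs : ∀ j, s j ≠ 0)
    (γ : τ → ℝ) (hW : ∀ i j, i ≠ j → ∃ w ∈ W, w i ≠ w j) (S : Finset W)
    (hS : ∀ z ∈ S, ∑ j, s j * Real.exp ((z : τ → ℝ) j + γ j) = 0) :
    S.card + 1 ≤ Fintype.card τ := by
  classical
  obtain ⟨z₀, -, hz₀⟩ := finrank_eq_one_iff'.1 hn
  choose r hr using hz₀
  have hinj : Function.Injective r := fun a b h => by rw [← hr a, h, hr]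
  have h1 := card_zeros_expSum_lt (fun j => s j * Real.exp (γ j)) (fun j => (z₀ : τ → ℝ) j)
    Finset.univ Finset.univ_nonempty (fun j _ => mul_ne_zero (hs j) (Real.exp_pos _).ne')
    (fun i _ j _ hij => by
      by_contra hne
      obtain ⟨w, hw, hwij⟩ := hW i j hne
      have h2 := congrArg Subtype.val (hr ⟨w, hw⟩)
      simp only [Submodule.coe_smul] at h2
      rw [← h2] at hwij
      simp only [Pi.smul_apply, smul_eq_mul] at hwij
      exact hwij (congrArg _ hij)) (S.image r) (fun t ht => by
      obtain ⟨z, hz, rfl⟩ := Finset.mem_image.1 ht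
      rw [← hS z hz]
      refine Finset.sum_congr rfl fun j _ => ?_
      have h2 : (z : τ → ℝ) j = r z * (z₀ : τ → ℝ) j := by
        conv_lhs => rw [← hr z]
        rfl
      rw [mul_assoc, ← Real.exp_add, h2]
      congr 2
      ring)
  rwa [Finset.card_image_of_injective _ hinj] at h1

theorem mem_connectedComponentIn_preimage_of_linearMap {E E' : Type*} [NormedAddCommGroup E]
    [NormedSpace ℝ E] [NormedAddCommGroup E'] [NormedSpace ℝ E'] [FiniteDimensional ℝ E']
    (P : E →ₗ[ℝ] E') (hP : LinearMap.range P = ⊤) {Z : Set E'} {x y : E} (hx : P x ∈ Z)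
    (h : P y ∈ connectedComponentIn Z (P x)) : y ∈ connectedComponentIn (P ⁻¹' Z) x := by
  obtain ⟨ψ, hψ⟩ := P.exists_rightInverse_of_surjective hP
  have hψ' : ∀ w, P (ψ w) = w := LinearMap.congr_fun hψ
  let q : E' × E → E := fun p => ψ p.1 + p.2
  have hq : Continuous q :=
    (ψ.continuous_of_finiteDimensional.comp continuous_fst).add continuous_snd
  have hpre : IsPreconnected (q '' (connectedComponentIn Z (P x) ×ˢ (LinearMap.ker P : Set E))) :=
    (isPreconnected_connectedComponentIn.prod
      (LinearMap.ker P).convex.isPreconnected).image q hq.continuousOn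
  have hmem : ∀ z, P z ∈ connectedComponentIn Z (P x) →
      z ∈ q '' (connectedComponentIn Z (P x) ×ˢ (LinearMap.ker P : Set E)) := fun z hz =>
    ⟨(P z, z - ψ (P z)), ⟨hz, by simp [hψ']⟩, by simp [q]⟩
  refine hpre.subset_connectedComponentIn (hmem x (mem_connectedComponentIn hx)) ?_ (hmem y h)
  rintro _ ⟨⟨w, κ⟩, ⟨hw, hκ⟩, rfl⟩
  have h1 : P (q (w, κ)) = w := by
    rw [map_add, hψ', LinearMap.mem_ker.1 hκ, add_zero]
  rw [Set.mem_preimage, h1]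
  exact connectedComponentIn_subset Z _ hw

theorem natCast_add_one_lt_fewnomial_bound (k : ℕ) : ((k + 1 : ℕ) : ℝ) <
    (Real.exp 1 ^ 2 + 3) / 4 * 2 ^ (k * (k + 1) / 2) * 2 ^ 1 * ((1 : ℕ) : ℝ) ^ (k + 1) := by
  have h1 : k + 1 ≤ 2 ^ k := Nat.lt_two_pow_self
  have h2 : k ≤ k * (k + 1) / 2 := by
    rw [Nat.le_div_iff_mul_le two_pos]
    rcases k with _ | k
    · simp
    · exact Nat.mul_le_mul_left _ (by omega)
  have h3 : ((k + 1 : ℕ) : ℝ) ≤ 2 ^ (k * (k + 1) / 2) := by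
    exact_mod_cast h1.trans (Nat.pow_le_pow_right two_pos h2)
  have h4 : (2 : ℝ) ≤ Real.exp 1 := by linarith [Real.add_one_le_exp (1 : ℝ)]
  have h5 : (0 : ℝ) < 2 ^ (k * (k + 1) / 2) := by positivity
  simp only [Nat.cast_one, one_pow, mul_one, pow_one]
  nlinarith

section PointConfiguration

variable {τ : Type*} [Fintype τ] {N : ℕ}

theorem exists_bound_card_components_expSum [DecidableEq τ] (n k : ℕ) (hn : 1 ≤ n)
    (A : τ → Fin N → ℝ) (hA : Function.Injective A)
    (hspan : Module.finrank ℝ (vectorSpan ℝ (Set.range A)) = n)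
    (hk : Fintype.card τ = n + k + 1) (s γ : τ → ℝ) (hs : ∀ j, s j = 1 ∨ s j = -1)
    (hreg : ∀ ζ : Fin N → ℝ, ∑ a, s a * Real.exp (A a ⬝ᵥ ζ + γ a) = 0 →
      ∃ h, ∑ a, s a * Real.exp (A a ⬝ᵥ ζ + γ a) * (A a ⬝ᵥ h) ≠ 0) :
    ∃ B : ℝ, B < (Real.exp 1 ^ 2 + 3) / 4 * 2 ^ (k * (k + 1) / 2) * 2 ^ n * (n : ℝ) ^ (k + 1) ∧
      ∀ S : Finset (Fin N → ℝ), (∀ ζ ∈ S, ∑ a, s a * Real.exp (A a ⬝ᵥ ζ + γ a) = 0) →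
        (∀ x ∈ S, ∀ y ∈ S, y ∈ connectedComponentIn
          {ζ | ∑ a, s a * Real.exp (A a ⬝ᵥ ζ + γ a) = 0} x → x = y) → (S.card : ℝ) ≤ B := by
  have hτ : Nonempty τ := Fintype.card_pos_iff.1 (by omega)
  set Λ := (Matrix.of A).mulVecLin with hΛ
  have hΛa : ∀ ζ a, Λ ζ a = A a ⬝ᵥ ζ := fun _ _ => rfl
  set H := LinearMap.range Λ ⊔ Submodule.span ℝ {(1 : τ → ℝ)} with hH
  have h1H : (1 : τ → ℝ) ∈ H := Submodule.mem_sup_right (Submodule.mem_span_singleton_self _)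
  have hHn : Module.finrank ℝ H = n + 1 := by rw [hH, finrank_range_mulVecLin_sup_span_one, hspan]
  obtain ⟨β, hβ, hgen⟩ := exists_transversal_weight H h1H s hs
  have hβ1 : β ⬝ᵥ 1 ≠ 0 := by
    rw [dotProduct_one]
    exact (Finset.sum_pos (fun j _ => hβ j) Finset.univ_nonempty).ne'
  have hWn := finrank_inf_ker_dotProduct H n hHn h1H β hβ
  set W := H ⊓ LinearMap.ker (dotProductBilin ℝ ℝ β) with hW
  have hWβ : ∀ w ∈ W, β ⬝ᵥ w = 0 := fun w hw => hw.2
  let r : (Fin N → ℝ) →ₗ[ℝ] ℝ := (β ⬝ᵥ 1)⁻¹ • (dotProductBilin ℝ ℝ β).comp Λ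
  have hr : ∀ ζ, r ζ * β ⬝ᵥ 1 = β ⬝ᵥ Λ ζ := fun ζ => by
    change (β ⬝ᵥ 1)⁻¹ * (β ⬝ᵥ Λ ζ) * β ⬝ᵥ 1 = β ⬝ᵥ Λ ζ
    field_simp
  let P : (Fin N → ℝ) →ₗ[ℝ] W := LinearMap.codRestrict W
    (Λ - r.smulRight (1 : τ → ℝ)) fun ζ => by
      refine ⟨H.sub_mem (Submodule.mem_sup_left ⟨ζ, rfl⟩) (H.smul_mem _ h1H), ?_⟩
      change β ⬝ᵥ (Λ ζ - r ζ • 1) = 0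
      rw [dotProduct_sub, dotProduct_smul, smul_eq_mul, hr, sub_self]
  have hP : ∀ ζ a, A a ⬝ᵥ ζ = (P ζ : τ → ℝ) a + r ζ := fun ζ a => by
    change _ = (Λ ζ a - r ζ * 1) + r ζ
    rw [hΛa]
    ring
  have hPr : LinearMap.range P = ⊤ := by
    rw [LinearMap.range_eq_top]
    rintro ⟨w, hw⟩
    obtain ⟨_, ⟨ζ, rfl⟩, z, hz, hsum⟩ := Submodule.mem_sup.1 hw.1
    obtain ⟨t, rfl⟩ := Submodule.mem_span_singleton.1 hz
    refine ⟨ζ, Subtype.ext ?_⟩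
    change Λ ζ - r ζ • 1 = w
    have h1 := hWβ w hw
    rw [← hsum, dotProduct_add, dotProduct_smul, smul_eq_mul, ← hr, ← add_mul] at h1
    rw [← hsum, ← eq_neg_of_add_eq_zero_right ((mul_eq_zero.1 h1).resolve_right hβ1) |>.symm,
      neg_smul, sub_eq_add_neg]
  have hexp : ∀ (c : τ → ℝ) ζ, ∑ a, s a * Real.exp (A a ⬝ᵥ ζ + γ a) * c a =
      Real.exp (r ζ) * ∑ a, s a * Real.exp ((P ζ : τ → ℝ) a + γ a) * c a := fun c ζ => by
    rw [Finset.mul_sum]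
    refine Finset.sum_congr rfl fun a _ => ?_
    rw [hP, show (P ζ : τ → ℝ) a + r ζ + γ a = r ζ + ((P ζ : τ → ℝ) a + γ a) by ring, Real.exp_add]
    ring
  have hzero : ∀ ζ, ∑ a, s a * Real.exp (A a ⬝ᵥ ζ + γ a) = 0 ↔
      ∑ a, s a * Real.exp ((P ζ : τ → ℝ) a + γ a) = 0 := fun ζ => by
    have h1 := hexp (fun _ => 1) ζ
    simp only [mul_one] at h1
    rw [h1, mul_eq_zero, or_iff_right (Real.exp_pos _).ne']
  have hregW : ∀ z : W, ∑ j, s j * Real.exp ((z : τ → ℝ) j + γ j) = 0 →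
      ∃ h : W, ∑ j, s j * Real.exp ((z : τ → ℝ) j + γ j) * (h : τ → ℝ) j ≠ 0 := by
    intro z hz
    obtain ⟨ζ, rfl⟩ := LinearMap.range_eq_top.1 hPr z
    obtain ⟨h, hh⟩ := hreg ζ ((hzero ζ).2 hz)
    refine ⟨P h, fun h0 => hh ?_⟩
    rw [hexp]
    simp only [hP h, mul_add, Finset.sum_add_distrib, h0, ← Finset.sum_mul, hz, zero_mul, add_zero,
      mul_zero]
  have htrans : ∀ S : Finset (Fin N → ℝ),
      (∀ ζ ∈ S, ∑ a, s a * Real.exp (A a ⬝ᵥ ζ + γ a) = 0) →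
        (∀ x ∈ S, ∀ y ∈ S, y ∈ connectedComponentIn
          {ζ | ∑ a, s a * Real.exp (A a ⬝ᵥ ζ + γ a) = 0} x → x = y) →
      ∃ S' : Finset W, S'.card = S.card ∧
        (∀ z ∈ S', ∑ j, s j * Real.exp ((z : τ → ℝ) j + γ j) = 0) ∧
        ∀ x ∈ S', ∀ y ∈ S', y ∈ connectedComponentIn
          {z : W | ∑ j, s j * Real.exp ((z : τ → ℝ) j + γ j) = 0} x → x = y := by
    classical
    intro S hS hd
    have hpre : {ζ | ∑ a, s a * Real.exp (A a ⬝ᵥ ζ + γ a) = 0} =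
        P ⁻¹' {z : W | ∑ j, s j * Real.exp ((z : τ → ℝ) j + γ j) = 0} :=
      Set.ext fun ζ => hzero ζ
    rw [hpre] at hd
    have hd' : ∀ x ∈ S, ∀ y ∈ S, P y ∈ connectedComponentIn
        {z : W | ∑ j, s j * Real.exp ((z : τ → ℝ) j + γ j) = 0} (P x) → x = y :=
      fun x hx y hy h => hd x hx y hy
        (mem_connectedComponentIn_preimage_of_linearMap P hPr ((hzero x).1 (hS x hx)) h)
    refine ⟨S.image P, Finset.card_image_of_injOn fun x hx y hy hxy => hd' x hx y hy ?_,
      fun z hz => ?_, fun z hz z' hz' h => ?_⟩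
    · rw [← hxy]
      exact mem_connectedComponentIn ((hzero x).1 (hS x hx))
    · obtain ⟨x, hx, rfl⟩ := Finset.mem_image.1 hz
      exact (hzero x).1 (hS x hx)
    · obtain ⟨x, hx, rfl⟩ := Finset.mem_image.1 hz
      obtain ⟨y, hy, rfl⟩ := Finset.mem_image.1 hz'
      rw [hd' x hx y hy h]
  rcases hn.eq_or_lt with rfl | hn2
  · refine ⟨((k + 1 : ℕ) : ℝ), natCast_add_one_lt_fewnomial_bound k, fun S hS hd => ?_⟩
    obtain ⟨S', hc, hS', -⟩ := htrans S hS hd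
    have h1 := card_zeros_lt_of_finrank_eq_one W hWn s
      (fun j => by rcases hs j with h | h <;> norm_num [h]) γ (fun i j hij => by
        obtain ⟨l, hl⟩ := Function.ne_iff.1 (hA.ne hij)
        refine ⟨P (Pi.single l 1), (P _).2, fun h => hl ?_⟩
        have h2 := hP (Pi.single l 1) i
        rw [h, ← hP] at h2
        simpa using h2) S' hS'
    rw [hk, hc] at h1
    exact_mod_cast (by omega : S.card ≤ k + 1)
  · refine ⟨_, one_add_rolleBound_lt n k hn2, fun S hS hd => ?_⟩
    obtain ⟨S', hc, hS', hd'⟩ := htrans S hS hd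
    rw [← hc]
    refine card_le_one_add_rolleBound W n k hWn hk s hs β hβ hWβ (fun e => ?_) γ hregW S' hS' hd'
    exact (hgen e).imp (fun ⟨w, hw, hwβ, ht⟩ => ⟨w, ⟨hw, hwβ⟩, ht⟩) fun h w hw => h w hw.1

end PointConfiguration

section Exp

variable {N : ℕ}

theorem prod_exp_pow (ζ : Fin N → ℝ) (a : Fin N →₀ ℕ) :
    ∏ i, Real.exp (ζ i) ^ a i = Real.exp ((fun i => (a i : ℝ)) ⬝ᵥ ζ) := by
  rw [dotProduct, Real.exp_sum]
  exact Finset.prod_congr rfl fun i _ => (Real.exp_nat_mul _ _).symm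

theorem MvPolynomial.eval_exp_eq_sum (f : MvPolynomial (Fin N) ℝ) (ζ : Fin N → ℝ) :
    MvPolynomial.eval (fun i => Real.exp (ζ i)) f =
      ∑ a : f.support, f.coeff a * Real.exp ((fun i => ((a : Fin N →₀ ℕ) i : ℝ)) ⬝ᵥ ζ) := by
  rw [MvPolynomial.eval_eq', ← Finset.sum_coe_sort]
  exact Finset.sum_congr rfl fun a _ => by rw [prod_exp_pow]

theorem MvPolynomial.exp_mul_eval_pderiv_eq_sum (f : MvPolynomial (Fin N) ℝ) (ζ : Fin N → ℝ)
    (l : Fin N) : Real.exp (ζ l) * MvPolynomial.eval (fun i => Real.exp (ζ i)) (pderiv l f) =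
      ∑ a : f.support, f.coeff a * Real.exp ((fun i => ((a : Fin N →₀ ℕ) i : ℝ)) ⬝ᵥ ζ) *
        ((a : Fin N →₀ ℕ) l : ℝ) := by
  have h1 : X l * pderiv l f = ∑ a ∈ f.support, a l • monomial a (f.coeff a) := by
    conv_lhs => rw [f.as_sum, map_sum, Finset.mul_sum]
    exact Finset.sum_congr rfl fun a _ => X_mul_pderiv_monomial
  have h2 := congrArg (MvPolynomial.eval fun i => Real.exp (ζ i)) h1
  rw [map_mul, MvPolynomial.eval_X] at h2
  rw [h2, map_sum, ← Finset.sum_coe_sort]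
  refine Finset.sum_congr rfl fun a _ => ?_
  rw [map_nsmul, MvPolynomial.eval_monomial, nsmul_eq_mul, ← prod_exp_pow,
    Finsupp.prod_fintype _ _ fun i => pow_zero _]
  ring

theorem exists_sign_mul_exp_eq {c : ℝ} (hc : c ≠ 0) :
    ∃ s γ : ℝ, (s = 1 ∨ s = -1) ∧ c = s * Real.exp γ := by
  rcases lt_or_gt_of_ne hc with h | h
  · exact ⟨-1, Real.log (-c), Or.inr rfl, by rw [Real.exp_log (neg_pos.2 h)]; ring⟩
  · exact ⟨1, Real.log c, Or.inl rfl, by rw [Real.exp_log h, one_mul]⟩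

theorem exists_finset_components_card_le {X : Set (Fin N → ℝ)} (hX : ∀ x ∈ X, ∀ i, 0 < x i)
    {B : ℝ} (hB : ∀ S : Finset (Fin N → ℝ), (∀ ζ ∈ S, (fun i => Real.exp (ζ i)) ∈ X) →
      (∀ x ∈ S, ∀ y ∈ S, y ∈ connectedComponentIn {ζ | (fun i => Real.exp (ζ i)) ∈ X} x → x = y) →
      (S.card : ℝ) ≤ B) :
    ∃ T : Finset (Set (Fin N → ℝ)), (T : Set (Set (Fin N → ℝ))) = components X ∧
      (T.card : ℝ) ≤ B := by
  classical
  refine Set.exists_finset_eq_card_le fun S hS => ?_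
  have hrep : ∀ C ∈ S, ∃ x ∈ X, C = connectedComponentIn X x := fun C hC => hS hC
  choose! x hxX hx using hrep
  let ζ : Set (Fin N → ℝ) → Fin N → ℝ := fun C i => Real.log (x C i)
  have hζ : ∀ C ∈ S, (fun i => Real.exp (ζ C i)) = x C := fun C hC =>
    funext fun i => Real.exp_log (hX _ (hxX C hC) i)
  have hinj : Set.InjOn ζ S := fun C hC D hD h => by
    rw [hx C hC, hx D hD, ← hζ C hC, ← hζ D hD, h]
  rw [← Finset.card_image_of_injOn hinj]
  refine hB _ (fun z hz => ?_) fun z hz z' hz' h => ?_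
  · obtain ⟨C, hC, rfl⟩ := Finset.mem_image.1 hz
    rw [hζ C hC]
    exact hxX C hC
  · obtain ⟨C, hC, rfl⟩ := Finset.mem_image.1 hz
    obtain ⟨D, hD, rfl⟩ := Finset.mem_image.1 hz'
    have hcont : Continuous fun (z : Fin N → ℝ) i => Real.exp (z i) :=
      continuous_pi fun i => Real.continuous_exp.comp (continuous_apply i)
    have hzC : ζ C ∈ {z : Fin N → ℝ | (fun i => Real.exp (z i)) ∈ X} := by
      change (fun i => Real.exp (ζ C i)) ∈ X
      rw [hζ C hC]
      exact hxX C hC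
    have h1 : (fun i => Real.exp (ζ D i)) ∈ connectedComponentIn X fun i => Real.exp (ζ C i) :=
      (isPreconnected_connectedComponentIn.image _ hcont.continuousOn).subset_connectedComponentIn
        (Set.mem_image_of_mem _ (mem_connectedComponentIn hzC))
        (Set.image_subset_iff.2 (connectedComponentIn_subset _ _)) (Set.mem_image_of_mem _ h)
    rw [hζ C hC, hζ D hD] at h1
    have h2 := connectedComponentIn_eq h1
    rw [← hx C hC, ← hx D hD] at h2
    rw [h2]

end Exp

/-- A smooth hypersurface in the positive orthant of `ℝ^N` defined by a
real polynomial with `n + k + 1` monomials whose exponent vectors have `n`-dimensional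
affine span has fewer than `((e² + 3)/4) · 2^(k(k+1)/2) · 2^n · n^(k+1)` connected
components; in particular, finitely many. -/
theorem fewnomial_hypersurface_bound (N n k : ℕ) (hn : 1 ≤ n)
    (f : MvPolynomial (Fin N) ℝ)
    (hcard : f.support.card = n + k + 1)
    (hspan : Module.finrank ℝ
      (affineSpan ℝ ((fun (a : Fin N →₀ ℕ) (i : Fin N) => (a i : ℝ)) '' ↑f.support)).direction
      = n)
    (X : Set (Fin N → ℝ))
    (hX : X = {x | (∀ i, 0 < x i) ∧ MvPolynomial.eval x f = 0})
    (hsmooth : ∀ x ∈ X, ∃ i, MvPolynomial.eval x (MvPolynomial.pderiv i f) ≠ 0) :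
    (components X).Finite ∧
    ((components X).ncard : ℝ) <
      (Real.exp 1 ^ 2 + 3) / 4 * 2 ^ (k * (k + 1) / 2) * 2 ^ n * (n : ℝ) ^ (k + 1) := by
  classical
  have hc : ∀ a : f.support, ∃ s γ : ℝ, (s = 1 ∨ s = -1) ∧ f.coeff a = s * Real.exp γ := fun a =>
    exists_sign_mul_exp_eq (MvPolynomial.mem_support_iff.1 a.2)
  choose s γ hs hsγ using hc
  let A : f.support → Fin N → ℝ := fun a i => ((a : Fin N →₀ ℕ) i : ℝ)
  have hA : Function.Injective A := fun a b h =>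
    Subtype.ext (Finsupp.ext fun i => Nat.cast_injective (congrFun h i))
  have hterm : ∀ ζ a, s a * Real.exp (A a ⬝ᵥ ζ + γ a) = f.coeff a * Real.exp (A a ⬝ᵥ ζ) :=
    fun ζ a => by
      rw [hsγ, Real.exp_add]
      ring
  have hmem : ∀ ζ : Fin N → ℝ, (fun i => Real.exp (ζ i)) ∈ X ↔
      ∑ a, s a * Real.exp (A a ⬝ᵥ ζ + γ a) = 0 := fun ζ => by
    rw [hX, Finset.sum_congr rfl fun a _ => hterm ζ a]
    exact (and_iff_right fun i => Real.exp_pos _).trans (by rw [f.eval_exp_eq_sum])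
  rw [direction_affineSpan, Set.image_eq_range] at hspan
  obtain ⟨B, hB, hB'⟩ := exists_bound_card_components_expSum n k hn A hA hspan (by simp [hcard]) s γ
    hs fun ζ hζ => by
      obtain ⟨l, hl⟩ := hsmooth _ ((hmem ζ).2 hζ)
      refine ⟨Pi.single l 1, ?_⟩
      simp only [hterm, dotProduct_single, mul_one]
      rw [← f.exp_mul_eval_pderiv_eq_sum ζ l]
      exact mul_ne_zero (Real.exp_pos _).ne' hl
  obtain ⟨T, hT, hTc⟩ := exists_finset_components_card_le (X := X) (B := B)
    (fun x hx => by
      rw [hX] at hx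
      exact hx.1)
    (by simpa only [hmem] using hB')
  rw [← hT, Set.ncard_coe_finset]
  exact ⟨T.finite_toSet, hTc.trans_lt hB⟩
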